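/- Convergence of the discrete kernel to Ψ. Fix k ∈ ℂ and 0 < y < x < 1. For a partition 0 = x₀ < x₁ < ⋯ < x_N = 1 and indices 1 ≤ m < j ≤ N−1, define Ψ_{j,m}(k) = √(σ_j/σ_m) · ( ∏_{p=m}^{j} 2σ_p/(σ_{p+1} + σ_p) ) · A_m(k) · B_j(k), where A_m(k) = ∑_{(ℓ₁,…,ℓ_m) ∈ {0,1}^m, ℓ₁ = 0} ( ∏_{p=1}^{m−1} (σ_{p+1} + (−1)^{ℓ_p+ℓ_{p+1}}σ_p)/(σ_{p+1}+σ_p) ) · sin( k ∑_{p=1}^{m} (−1)^{ℓ_p} Δx_p/σ_p ) and B_j(k) = ∑_{(ℓ_{j+1},…,ℓ_N) ∈ {0,1}^{N−j}, ℓ_{j+1} = 0} ( ∏_{p=j+1}^{N−1} (σ_{p+1} + (−1)^{ℓ_p+ℓ_{p+1}}σ_p)/(σ_{p+1}+σ_p) ) · sin( k ∑_{p=j+1}^{N} (−1)^{ℓ_p} Δx_p/σ_p ). Then for every sequence of partitions with mesh tending to 0 and indices m_N < j_N such that x_{m_N} → y and x_{j_N} → x, one has Ψ_{j_N, m_N}(k)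 → Ψ(k,x,y). -/

import Mathlib

open MeasureTheory Filter

noncomputable section

/-- Nodes of the simplex: `y₀ = a`, `y_{n+1} = b`, interior nodes from `y`. -/
def nodes (a b : ℝ) (n : ℕ) (y : Fin n → ℝ) (p : ℕ) : ℝ :=
  if h : 1 ≤ p ∧ p ≤ n then y ⟨p - 1, by omega⟩ else if p = 0 then a else b

/-- The ordered simplex `a ≤ y₁ ≤ ⋯ ≤ y_n ≤ b`. -/
def simplex (a b : ℝ) (n : ℕ) : Set (Fin n → ℝ) :=
  {y | Monotone y ∧ ∀ i, y i ∈ Set.Icc a b}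

/-- The alternating phase `∑_{p=0}^{n} (−1)^p ∫_{y_p}^{y_{p+1}} dξ/σ(ξ)`. -/
def phase (σ : ℝ → ℝ) (a b : ℝ) (n : ℕ) (y : Fin n → ℝ) : ℝ :=
  ∑ p ∈ Finset.range (n + 1),
    (-1 : ℝ) ^ p * ∫ ξ in (nodes a b n y p)..(nodes a b n y (p + 1)), 1 / σ ξ

/-- The integrand defining `S_n^{(a,b)}(k)`. -/
def Sintegrand (σ : ℝ → ℝ) (a b : ℝ) (n : ℕ) (k : ℂ) (y : Fin n → ℝ) : ℂ :=
  ((∏ p, deriv σ (y p) / σ (y p) : ℝ) : ℂ) * Complex.sin (k * ((phase σ a b n y : ℝ) : ℂ))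

/-- `S_n^{(a,b)}(k)`. -/
def S (σ : ℝ → ℝ) (a b : ℝ) (n : ℕ) (k : ℂ) : ℂ :=
  ((2 : ℂ) ^ n)⁻¹ * ∫ y in simplex a b n, Sintegrand σ a b n k y

/-- `Δ(k) = ∑_{n=0}^∞ S_n^{(0,1)}(k)`. -/
def Δfun (σ : ℝ → ℝ) (k : ℂ) : ℂ := ∑' n, S σ 0 1 n k

/-- `σ` is absolutely continuous on `[0,1]`: fundamental-theorem-of-calculus
characterization with integrable derivative. -/
def sigmaAC (σ : ℝ → ℝ) : Prop :=
  IntegrableOn (deriv σ) (Set.Icc 0 1) ∧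
    ∀ x ∈ Set.Icc (0 : ℝ) 1, σ x = σ 0 + ∫ t in (0 : ℝ)..x, deriv σ t

/-- `Ψ(k,x,y)`, defined symmetrically. -/
def Psi (σ : ℝ → ℝ) (k : ℂ) (x y : ℝ) : ℂ :=
  if y ≤ x then (∑' n, S σ 0 y n k) * (∑' n, S σ x 1 n k)
  else (∑' n, S σ 0 x n k) * (∑' n, S σ y 1 n k)

/-- Read off the entry `ℓ_p` (for `1 ≤ p ≤ N`) of a binary vector `ℓ ∈ {0,1}^N`,
encoded as `ℓ : Fin N → Bool`; out-of-range indices give `false`. -/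
def entry (N : ℕ) (ℓ : Fin N → Bool) (p : ℕ) : Bool :=
  if h : 1 ≤ p ∧ p ≤ N then ℓ ⟨p - 1, by omega⟩ else false

/-- `A_m(k) = ∑_{(ℓ₁,…,ℓ_m) ∈ {0,1}^m, ℓ₁=0} (∏_{p=1}^{m-1} Λ_p^±/Λ_p^+)
sin(k ∑_{p=1}^{m} (−1)^{ℓ_p} Δx_p/σ_p)` for a partition `x`, where `σ_p = σ(x_p)` and
`Δx_p = x_p − x_{p−1}`. -/
def Asum (σ : ℝ → ℝ) (k : ℂ) (m : ℕ) (x : ℕ → ℝ) : ℂ :=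
  ∑ ℓ : Fin m → Bool,
    if entry m ℓ 1 = false then
      ((∏ p ∈ Finset.Ico 1 m,
          (σ (x (p + 1)) +
            (if entry m ℓ p = entry m ℓ (p + 1) then σ (x p) else -σ (x p))) /
            (σ (x (p + 1)) + σ (x p)) : ℝ) : ℂ) *
        Complex.sin (k * ((∑ p ∈ Finset.Icc 1 m,
          (if entry m ℓ p then (-1 : ℝ) else 1) * (x p - x (p - 1)) / σ (x p) : ℝ) : ℂ))
    else 0

/-- Read off the entry `ℓ_p` (for `j+1 ≤ p ≤ N`) of a binary vector
`(ℓ_{j+1},…,ℓ_N) ∈ {0,1}^{N−j}`, encoded as `ℓ : Fin (N−j) → Bool`. -/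
def entryB (j N : ℕ) (ℓ : Fin (N - j) → Bool) (p : ℕ) : Bool :=
  if h : j + 1 ≤ p ∧ p ≤ N then ℓ ⟨p - j - 1, by omega⟩ else false

/-- `B_j(k) = ∑_{(ℓ_{j+1},…,ℓ_N) ∈ {0,1}^{N-j}, ℓ_{j+1}=0} (∏_{p=j+1}^{N-1} Λ_p^±/Λ_p^+)
sin(k ∑_{p=j+1}^{N} (−1)^{ℓ_p} Δx_p/σ_p)`. -/
def Bsum (σ : ℝ → ℝ) (k : ℂ) (j N : ℕ) (x : ℕ → ℝ) : ℂ :=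
  ∑ ℓ : Fin (N - j) → Bool,
    if entryB j N ℓ (j + 1) = false then
      ((∏ p ∈ Finset.Ico (j + 1) N,
          (σ (x (p + 1)) +
            (if entryB j N ℓ p = entryB j N ℓ (p + 1) then σ (x p) else -σ (x p))) /
            (σ (x (p + 1)) + σ (x p)) : ℝ) : ℂ) *
        Complex.sin (k * ((∑ p ∈ Finset.Icc (j + 1) N,
          (if entryB j N ℓ p then (-1 : ℝ) else 1) * (x p - x (p - 1)) / σ (x p) : ℝ) : ℂ))
    else 0

/-- The discrete kernel
`Ψ_{j,m}(k) = √(σ_j/σ_m) (∏_{p=m}^{j} 2σ_p/(σ_{p+1}+σ_p)) A_m(k) B_j(k)`. -/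
def PsiDisc (σ : ℝ → ℝ) (k : ℂ) (N : ℕ) (x : ℕ → ℝ) (j m : ℕ) : ℂ :=
  ((Real.sqrt (σ (x j) / σ (x m)) *
      ∏ p ∈ Finset.Icc m j, 2 * σ (x p) / (σ (x (p + 1)) + σ (x p)) : ℝ) : ℂ) *
    Asum σ k m x * Bsum σ k j N x


/-! ### The kernel series as a solution of a linear system -/

/-- Iterated integrals `∫_{a ≤ y₁ ≤ ⋯ ≤ y_n ≤ x} ∏ h_p(y_p)`, as a function of `x`. -/
def iterInt (h : ℕ → ℝ → ℂ) (a : ℝ) : ℕ → ℝ → ℂ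
  | 0 => fun _ => 1
  | n + 1 => fun x => ∫ t in a..x, h n t * iterInt h a n t

theorem continuous_iterInt {h : ℕ → ℝ → ℂ} (hh : ∀ n, Continuous (h n)) (a : ℝ) (n : ℕ) :
    Continuous (iterInt h a n) := by
  induction n with
  | zero => exact continuous_const
  | succ n ih =>
    exact intervalIntegral.continuous_primitive
      (fun _ _ => ((hh n).mul ih).intervalIntegrable _ _) a

theorem hasDerivAt_iterInt_succ {h : ℕ → ℝ → ℂ} (hh : ∀ n, Continuous (h n)) (a : ℝ) (n : ℕ)
    (x : ℝ) : HasDerivAt (iterInt h a (n + 1)) (h n x * iterInt h a n x) x := by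
  have hc : Continuous fun t => h n t * iterInt h a n t := (hh n).mul (continuous_iterInt hh a n)
  exact intervalIntegral.integral_hasDerivAt_right (hc.intervalIntegrable _ _)
    (hc.stronglyMeasurableAtFilter _ _) hc.continuousAt

theorem norm_iterInt_le {h : ℕ → ℝ → ℂ} {a C : ℝ} {s : Set ℝ} (hs : s.OrdConnected)
    (ha : a ∈ s) (hC : ∀ n, ∀ t ∈ s, ‖h n t‖ ≤ C) (n : ℕ) :
    ∀ x ∈ s, ‖iterInt h a n x‖ ≤ (C * |x - a|) ^ n / n.factorial := by
  have hC0 : 0 ≤ C := (norm_nonneg _).trans (hC 0 a ha)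
  induction n with
  | zero => intro x _; simp [iterInt]
  | succ n ih =>
    intro x hx
    have hsub : Set.uIoc a x ⊆ s := Set.uIoc_subset_uIcc.trans (hs.uIcc_subset ha hx)
    calc ‖iterInt h a (n + 1) x‖
        = ‖∫ t in Set.uIoc a x, h n t * iterInt h a n t‖ :=
          intervalIntegral.norm_intervalIntegral_eq _ _ _ _
      _ ≤ ∫ t in Set.uIoc a x, C ^ (n + 1) / n.factorial * |t - a| ^ n := by
          refine norm_integral_le_of_norm_le ?_ ?_
          · exact (Continuous.integrableOn_uIcc (by fun_prop)).mono_set Set.uIoc_subset_uIcc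
          · refine (ae_restrict_iff' measurableSet_uIoc).2 (Eventually.of_forall fun t ht => ?_)
            rw [norm_mul]
            calc ‖h n t‖ * ‖iterInt h a n t‖
                ≤ C * ((C * |t - a|) ^ n / n.factorial) :=
                  mul_le_mul (hC n t (hsub ht)) (ih t (hsub ht)) (norm_nonneg _) hC0
              _ = _ := by rw [mul_pow]; ring
      _ = (C * |x - a|) ^ (n + 1) / (n + 1).factorial := by
          rw [integral_const_mul, integral_pow_abs_sub_uIoc, Nat.factorial_succ, mul_pow]
          push_cast
          field_simp

/-- Travel time `∫_a^x κ`. -/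
def travelTime (κ : ℝ → ℝ) (a x : ℝ) : ℝ := ∫ t in a..x, κ t

/-- The weight attached to the `n`-th reflection. -/
def reflWeight (κ ρ : ℝ → ℝ) (a : ℝ) (k : ℂ) (n : ℕ) (t : ℝ) : ℂ :=
  ρ t * Complex.exp (2 * (Complex.I * k * (-1) ^ n * travelTime κ a t))

/-- Contribution with `n` reflections to the transmitted exponential wave. -/
def reflTerm (κ ρ : ℝ → ℝ) (a : ℝ) (k : ℂ) (n : ℕ) (x : ℝ) : ℂ :=
  Complex.exp (Complex.I * k * (-1) ^ n * travelTime κ a x) * iterInt (reflWeight κ ρ a k) a n x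

/-- The series `∑ sⁿ F_n` over the number of reflections. -/
def reflSeries (κ ρ : ℝ → ℝ) (a : ℝ) (k : ℂ) (s : ℂ) (x : ℝ) : ℂ :=
  ∑' n, s ^ n * reflTerm κ ρ a k n x

theorem hasDerivAt_travelTime {κ : ℝ → ℝ} (hκ : Continuous κ) (a x : ℝ) :
    HasDerivAt (travelTime κ a) (κ x) x :=
  intervalIntegral.integral_hasDerivAt_right (hκ.intervalIntegrable _ _)
    (hκ.stronglyMeasurableAtFilter _ _) hκ.continuousAt

theorem continuous_travelTime {κ : ℝ → ℝ} (hκ : Continuous κ) (a : ℝ) :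
    Continuous (travelTime κ a) :=
  continuous_iff_continuousAt.2 fun x => (hasDerivAt_travelTime hκ a x).continuousAt

theorem continuous_reflWeight {κ ρ : ℝ → ℝ} (hκ : Continuous κ) (hρ : Continuous ρ) (a : ℝ)
    (k : ℂ) (n : ℕ) : Continuous (reflWeight κ ρ a k n) := by
  have := continuous_travelTime hκ a
  unfold reflWeight
  fun_prop

theorem hasDerivAt_exp_travelTime {κ : ℝ → ℝ} (hκ : Continuous κ) (a : ℝ) (c : ℂ) (x : ℝ) :
    HasDerivAt (fun x => Complex.exp (c * travelTime κ a x))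
      (c * κ x * Complex.exp (c * travelTime κ a x)) x := by
  have h := ((hasDerivAt_travelTime hκ a x).ofReal_comp.const_mul c).cexp
  convert h using 1
  ring

theorem hasDerivAt_reflTerm_zero {κ : ℝ → ℝ} (hκ : Continuous κ) (ρ : ℝ → ℝ) (a : ℝ) (k : ℂ)
    (x : ℝ) :
    HasDerivAt (reflTerm κ ρ a k 0) (Complex.I * k * κ x * reflTerm κ ρ a k 0 x) x := by
  have h := hasDerivAt_exp_travelTime hκ a (Complex.I * k * (-1) ^ 0) x
  convert h using 1
  · funext t; simp [reflTerm, iterInt]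
  · simp [reflTerm, iterInt]

theorem hasDerivAt_reflTerm_succ {κ ρ : ℝ → ℝ} (hκ : Continuous κ) (hρ : Continuous ρ) (a : ℝ)
    (k : ℂ) (n : ℕ) (x : ℝ) :
    HasDerivAt (reflTerm κ ρ a k (n + 1))
      ((-1) ^ (n + 1) * (Complex.I * k * κ x) * reflTerm κ ρ a k (n + 1) x
        + ρ x * reflTerm κ ρ a k n x) x := by
  have h := (hasDerivAt_exp_travelTime hκ a (Complex.I * k * (-1) ^ (n + 1)) x).mul
    (hasDerivAt_iterInt_succ (continuous_reflWeight hκ hρ a k) a n x)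
  refine HasDerivAt.congr_deriv h ?_
  have e : Complex.exp (Complex.I * k * (-1) ^ n * travelTime κ a x)
      = Complex.exp (Complex.I * k * (-1) ^ (n + 1) * travelTime κ a x) *
        Complex.exp (2 * (Complex.I * k * (-1) ^ n * travelTime κ a x)) := by
    rw [← Complex.exp_add]; congr 1; ring
  simp only [reflTerm, reflWeight]
  rw [e]
  ring

theorem exists_summable_bound_reflTerm {κ ρ : ℝ → ℝ} (hκ : Continuous κ) (hρ : Continuous ρ)
    {a : ℝ} (k : ℂ) {l u : ℝ} (ha : a ∈ Set.Icc l u) :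
    ∃ v : ℕ → ℝ, Summable v ∧ ∀ n, ∀ x ∈ Set.Icc l u, ‖reflTerm κ ρ a k n x‖ ≤ v n := by
  have hτ := continuous_travelTime hκ a
  have bound (f : ℕ → ℝ → ℂ) (hf : ∀ n, Continuous (f n)) (hp : ∀ n, f n = f 0 ∨ f n = f 1) :
      ∃ C, ∀ n, ∀ t ∈ Set.Icc l u, ‖f n t‖ ≤ C := by
    obtain ⟨C₀, h₀⟩ := isCompact_Icc.exists_bound_of_continuousOn (s := Set.Icc l u)
      (hf 0).continuousOn
    obtain ⟨C₁, h₁⟩ := isCompact_Icc.exists_bound_of_continuousOn (s := Set.Icc l u)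
      (hf 1).continuousOn
    refine ⟨max C₀ C₁, fun n t ht => ?_⟩
    rcases hp n with h | h <;> rw [h]
    · exact (h₀ t ht).trans (le_max_left _ _)
    · exact (h₁ t ht).trans (le_max_right _ _)
  obtain ⟨C, hC⟩ := bound (reflWeight κ ρ a k) (continuous_reflWeight hκ hρ a k) (fun n => by
    rcases neg_one_pow_eq_or ℂ n with h | h <;> simp [funext_iff, reflWeight, h])
  obtain ⟨M, hM⟩ := bound
    (fun n x => Complex.exp (Complex.I * k * (-1) ^ n * travelTime κ a x))
    (fun n => by fun_prop) (fun n => by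
      rcases neg_one_pow_eq_or ℂ n with h | h <;> simp [h])
  have hM0 : 0 ≤ M := (norm_nonneg _).trans (hM 0 a ha)
  have hC0 : 0 ≤ C := (norm_nonneg _).trans (hC 0 a ha)
  refine ⟨fun n => M * ((C * (u - l)) ^ n / n.factorial),
    (Real.summable_pow_div_factorial _).mul_left M, fun n x hx => ?_⟩
  rw [reflTerm, norm_mul]
  refine mul_le_mul (hM n x hx) ?_ (norm_nonneg _) hM0
  refine (norm_iterInt_le Set.ordConnected_Icc ha hC n x hx).trans ?_
  have : |x - a| ≤ u - l := by
    rw [abs_le]; constructor <;> linarith [ha.1, ha.2, hx.1, hx.2]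
  gcongr

theorem summable_reflTerm {κ ρ : ℝ → ℝ} (hκ : Continuous κ) (hρ : Continuous ρ)
    (a : ℝ) (k : ℂ) (x : ℝ) : Summable fun n => reflTerm κ ρ a k n x := by
  obtain ⟨v, hv, h⟩ := exists_summable_bound_reflTerm hκ hρ k
    (a := a) (l := min a x) (u := max a x) ⟨min_le_left _ _, le_max_left _ _⟩
  exact .of_norm_bounded hv fun n => h n x ⟨min_le_right _ _, le_max_right _ _⟩

theorem summable_pow_mul_reflTerm {κ ρ : ℝ → ℝ} (hκ : Continuous κ) (hρ : Continuous ρ)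
    (a : ℝ) (k : ℂ) {s : ℂ} (hs : ‖s‖ ≤ 1) (x : ℝ) :
    Summable fun n => s ^ n * reflTerm κ ρ a k n x := by
  refine .of_norm_bounded (summable_reflTerm hκ hρ a k x).norm fun n => ?_
  rw [norm_mul, norm_pow]
  exact mul_le_of_le_one_left (norm_nonneg _) (pow_le_one₀ (norm_nonneg _) hs)

theorem reflSeries_self {κ ρ : ℝ → ℝ} (a : ℝ) (k s : ℂ) : reflSeries κ ρ a k s a = 1 := by
  rw [reflSeries, tsum_eq_single 0]
  · simp [reflTerm, iterInt, travelTime]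
  · rintro (_ | n) hn
    · exact absurd rfl hn
    · simp [reflTerm, iterInt]

theorem hasDerivAt_reflSeries {κ ρ : ℝ → ℝ} (hκ : Continuous κ) (hρ : Continuous ρ)
    (a : ℝ) (k : ℂ) {s : ℂ} (hs : ‖s‖ ≤ 1) (x : ℝ) :
    HasDerivAt (reflSeries κ ρ a k s)
      (Complex.I * k * κ x * reflSeries κ ρ a k (-s) x + s * ρ x * reflSeries κ ρ a k s x) x := by
  set l := min a x - 1
  set u := max a x + 1
  have ha : a ∈ Set.Ioo l u :=
    ⟨by linarith [min_le_left a x], by linarith [le_max_left a x]⟩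
  have hx : x ∈ Set.Ioo l u :=
    ⟨by linarith [min_le_right a x], by linarith [le_max_right a x]⟩
  obtain ⟨v, hv, hF⟩ := exists_summable_bound_reflTerm hκ hρ k (Set.Ioo_subset_Icc_self ha)
  obtain ⟨B₁, hB₁⟩ := isCompact_Icc.exists_bound_of_continuousOn (s := Set.Icc l u)
    (f := fun x => Complex.I * k * κ x) (by fun_prop)
  obtain ⟨B₂, hB₂⟩ := isCompact_Icc.exists_bound_of_continuousOn (s := Set.Icc l u)
    (f := fun x => (ρ x : ℂ)) (by fun_prop)
  have hB₁0 := (norm_nonneg _).trans (hB₁ a (Set.Ioo_subset_Icc_self ha))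
  have hB₂0 := (norm_nonneg _).trans (hB₂ a (Set.Ioo_subset_Icc_self ha))
  let d : ℕ → ℝ → ℂ := fun n x => s ^ n * ((-1) ^ n * (Complex.I * k * κ x) * reflTerm κ ρ a k n x
    + if n = 0 then 0 else ρ x * reflTerm κ ρ a k (n - 1) x)
  let w : ℕ → ℝ := fun n => B₁ * v n + B₂ * if n = 0 then 0 else v (n - 1)
  have hw : Summable w := by
    refine (hv.mul_left _).add (Summable.mul_left _ ?_)
    rw [← summable_nat_add_iff 1]
    simpa using hv
  have hd : ∀ n y, y ∈ Set.Ioo l u → HasDerivAt (fun x => s ^ n * reflTerm κ ρ a k n x) (d n y) y := by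
    rintro (_ | n) y -
    · simpa [d] using hasDerivAt_reflTerm_zero hκ ρ a k y
    · simpa [d] using (hasDerivAt_reflTerm_succ hκ hρ a k n y).const_mul (s ^ (n + 1))
  have hdw : ∀ n y, y ∈ Set.Ioo l u → ‖d n y‖ ≤ w n := by
    intro n y hy
    have hy' := Set.Ioo_subset_Icc_self hy
    simp only [d, w, norm_mul (s ^ n), norm_pow]
    refine (mul_le_of_le_one_left (norm_nonneg _) (pow_le_one₀ (norm_nonneg _) hs)).trans ?_
    refine (norm_add_le _ _).trans (add_le_add ?_ ?_)
    · rw [norm_mul, norm_mul, norm_pow, norm_neg, norm_one, one_pow, one_mul]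
      exact mul_le_mul (hB₁ y hy') (hF n y hy') (norm_nonneg _) hB₁0
    · split_ifs
      · simp
      · rw [norm_mul]
        exact mul_le_mul (hB₂ y hy') (hF _ y hy') (norm_nonneg _) hB₂0
  have key := hasDerivAt_tsum_of_isPreconnected hw isOpen_Ioo isPreconnected_Ioo hd hdw ha
    (summable_pow_mul_reflTerm hκ hρ a k hs a) hx
  refine HasDerivAt.congr_deriv key ?_
  have hs' : ‖-s‖ ≤ 1 := by rwa [norm_neg]
  have h₁ := (summable_pow_mul_reflTerm hκ hρ a k hs' x).mul_left (Complex.I * k * κ x)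
  have h₂ := (summable_pow_mul_reflTerm hκ hρ a k hs x).mul_left (s * ρ x)
  have h₃ : Summable fun n => if n = 0 then 0 else
      s ^ n * (ρ x * reflTerm κ ρ a k (n - 1) x) := by
    rw [← summable_nat_add_iff 1]
    refine h₂.congr fun n => ?_
    simp [pow_succ]; ring
  have e₃ : ∑' n, (if n = 0 then 0 else s ^ n * (ρ x * reflTerm κ ρ a k (n - 1) x))
      = s * ρ x * reflSeries κ ρ a k s x := by
    rw [h₃.tsum_eq_zero_add, reflSeries, ← tsum_mul_left, if_pos rfl, zero_add]
    refine tsum_congr fun n => ?_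
    simp [pow_succ]; ring
  rw [← e₃, reflSeries, ← tsum_mul_left, ← h₁.tsum_add h₃]
  refine tsum_congr fun n => ?_
  simp only [d]
  rw [neg_pow s]
  split_ifs <;> ring

/-! ### The simplex integrals -/

theorem isCompact_simplex (a b : ℝ) (n : ℕ) : IsCompact (simplex a b n) := by
  have h : simplex a b n = Set.Icc (fun _ => a) (fun _ => b) ∩ {y | Monotone y} := by
    ext y
    simp only [simplex, Set.mem_ofPred_eq, Set.mem_inter_iff, Set.mem_Icc, Pi.le_def, forall_and,
      and_comm]
  rw [h]
  refine isCompact_Icc.inter_right ?_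
  have : {y : Fin n → ℝ | Monotone y} = ⋂ i, ⋂ j, ⋂ (_ : i ≤ j), {y | y i ≤ y j} := by
    ext y; simp [Monotone]
  rw [this]
  exact isClosed_iInter fun i => isClosed_iInter fun j => isClosed_iInter fun _ =>
    isClosed_le (continuous_apply i) (continuous_apply j)

theorem insertNth_last_mem_simplex (a b : ℝ) (n : ℕ) (t : ℝ) (y : Fin n → ℝ) :
    (Fin.last n).insertNth t y ∈ simplex a b (n + 1) ↔
      t ∈ Set.Icc a b ∧ y ∈ simplex a t n := by
  simp only [simplex, Set.mem_ofPred_eq, Fin.insertNth_last']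
  constructor
  · rintro ⟨hm, hb⟩
    refine ⟨by simpa using hb (Fin.last n), fun i j hij => ?_, fun i => ⟨?_, ?_⟩⟩
    · simpa using hm (Fin.castSucc_le_castSucc_iff.2 hij)
    · simpa using (hb i.castSucc).1
    · simpa using hm (Fin.le_last i.castSucc)
  · rintro ⟨ht, hm, hb⟩
    refine ⟨fun i j hij => ?_, fun i => ?_⟩
    · induction j using Fin.lastCases with
      | last =>
        induction i using Fin.lastCases with
        | last => rfl
        | cast i => simpa using (hb i).2
      | cast j =>
        induction i using Fin.lastCases with
        | last => exact absurd hij (not_le.2 (Fin.castSucc_lt_last j))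
        | cast i => simpa using hm (Fin.castSucc_le_castSucc_iff.1 hij)
    · induction i using Fin.lastCases with
      | last => simpa using ht
      | cast i => simpa using ⟨(hb i).1, (hb i).2.trans ht.2⟩

theorem setIntegral_simplex_prod {h : ℕ → ℝ → ℂ} (hh : ∀ n, Continuous (h n)) (a : ℝ) (n : ℕ) :
    ∀ b, a ≤ b → ∫ y in simplex a b n, ∏ p : Fin n, h p (y p) = iterInt h a n b := by
  induction n with
  | zero =>
    intro b _
    have : simplex a b 0 = Set.univ := by
      ext y; simp [simplex, Subsingleton.monotone]
    simp [this, iterInt, measureReal_def, volume_pi]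
  | succ n ih =>
    intro b hab
    have hc : Continuous fun y : Fin (n + 1) → ℝ => ∏ p : Fin (n + 1), h p (y p) :=
      continuous_finsetProd _ fun p _ => (hh p).comp (continuous_apply p)
    have hint := hc.continuousOn.integrableOn_compact (μ := volume) (isCompact_simplex a b (n + 1))
    have hmeas := (isCompact_simplex a b (n + 1)).measurableSet
    have mp := (volume_preserving_piFinSuccAbove (fun _ : Fin (n + 1) => ℝ) (Fin.last n)).symm
    have hind := (integrable_indicator_iff hmeas).2 hint
    have hindp := (mp.integrable_comp_emb (MeasurableEquiv.measurableEmbedding _)).2 hind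
    rw [← integral_indicator hmeas,
      ← mp.integral_comp (MeasurableEquiv.measurableEmbedding _)]
    refine (integral_prod _ hindp).trans ?_
    have inner (t : ℝ) :
        ∫ y, (simplex a b (n + 1)).indicator (fun y => ∏ p : Fin (n + 1), h p (y p))
          ((MeasurableEquiv.piFinSuccAbove (fun _ : Fin (n + 1) => ℝ) (Fin.last n)).symm (t, y))
        = (Set.Icc a b).indicator (fun t => h n t * iterInt h a n t) t := by
      by_cases ht : t ∈ Set.Icc a b
      · rw [Set.indicator_of_mem ht, ← ih t ht.1, ← integral_const_mul,
          ← integral_indicator (isCompact_simplex a t n).measurableSet]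
        congr 1
        funext y
        change (simplex a b (n + 1)).indicator (fun y => ∏ p : Fin (n + 1), h p (y p))
          ((Fin.last n).insertNth t y) = _
        by_cases hy : y ∈ simplex a t n
        · rw [Set.indicator_of_mem ((insertNth_last_mem_simplex a b n t y).2 ⟨ht, hy⟩),
            Set.indicator_of_mem hy, Fin.prod_univ_castSucc, mul_comm]
          simp
        · rw [Set.indicator_of_notMem hy, Set.indicator_of_notMem]
          rw [insertNth_last_mem_simplex]
          exact fun h => hy h.2
      · rw [Set.indicator_of_notMem ht]
        refine integral_eq_zero_of_ae (Eventually.of_forall fun y => ?_)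
        exact Set.indicator_of_notMem
          (fun hy => ht ((insertNth_last_mem_simplex a b n t y).1 hy).1) _
    refine (integral_congr_ae (Eventually.of_forall inner)).trans ?_
    rw [integral_indicator measurableSet_Icc,
      integral_Icc_eq_integral_Ioc, ← intervalIntegral.integral_of_le hab, iterInt]

theorem alternating_sum_sub (c : ℕ → ℝ) (n : ℕ) :
    ∑ p ∈ Finset.range (n + 1), (-1 : ℝ) ^ p * (c (p + 1) - c p)
      = (-1) ^ n * c (n + 1) + 2 * ∑ p ∈ Finset.range n, (-1 : ℝ) ^ p * c (p + 1) - c 0 := by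
  induction n with
  | zero => simp
  | succ n ih =>
    rw [Finset.sum_range_succ, ih, Finset.sum_range_succ _ n]
    ring

theorem nodes_mem {a b : ℝ} (hab : a ≤ b) {n : ℕ} {y : Fin n → ℝ} (hy : y ∈ simplex a b n)
    (p : ℕ) : nodes a b n y p ∈ Set.Icc a b := by
  unfold nodes
  split_ifs
  · exact hy.2 _
  · exact Set.left_mem_Icc.2 hab
  · exact Set.right_mem_Icc.2 hab

theorem phase_eq {σ κ : ℝ → ℝ} (hκ : Continuous κ) {a b : ℝ} (hab : a ≤ b)
    (hσκ : ∀ x ∈ Set.Icc a b, 1 / σ x = κ x) {n : ℕ} {y : Fin n → ℝ} (hy : y ∈ simplex a b n) :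
    phase σ a b n y = (-1) ^ n * travelTime κ a b
      + 2 * ∑ p : Fin n, (-1 : ℝ) ^ (p : ℕ) * travelTime κ a (y p) := by
  have h₁ : phase σ a b n y = ∑ p ∈ Finset.range (n + 1), (-1 : ℝ) ^ p *
      (travelTime κ a (nodes a b n y (p + 1)) - travelTime κ a (nodes a b n y p)) := by
    refine Finset.sum_congr rfl fun p _ => ?_
    rw [travelTime, travelTime, intervalIntegral.integral_interval_sub_left
      (hκ.intervalIntegrable _ _) (hκ.intervalIntegrable _ _)]
    congr 1
    refine intervalIntegral.integral_congr fun x hx => hσκ x ?_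
    exact Set.ordConnected_Icc.uIcc_subset (nodes_mem hab hy _) (nodes_mem hab hy _) hx
  rw [h₁, alternating_sum_sub (fun p => travelTime κ a (nodes a b n y p)), ← Fin.sum_univ_eq_sum_range
    (fun p => (-1 : ℝ) ^ p * travelTime κ a (nodes a b n y (p + 1)))]
  have e₀ : nodes a b n y 0 = a := by simp [nodes]
  have e₁ : nodes a b n y (n + 1) = b := by simp [nodes]
  have e₂ : ∀ p : Fin n, nodes a b n y (p + 1) = y p := fun p => by simp [nodes, p.2]
  simp only [e₀, e₁, e₂]
  simp [travelTime]

theorem setIntegral_simplex_exp {σ κ ρ : ℝ → ℝ} (hκ : Continuous κ) (hρ : Continuous ρ)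
    {a b : ℝ} (hab : a ≤ b) (hσκ : ∀ x ∈ Set.Icc a b, 1 / σ x = κ x) (k : ℂ) (n : ℕ) :
    ∫ y in simplex a b n, (∏ p : Fin n, (ρ (y p) : ℂ)) *
      Complex.exp (Complex.I * k * phase σ a b n y) = reflTerm κ ρ a k n b := by
  rw [reflTerm, ← setIntegral_simplex_prod (continuous_reflWeight hκ hρ a k) a n b hab,
    ← integral_const_mul]
  refine setIntegral_congr_fun (isCompact_simplex a b n).measurableSet fun y hy => ?_
  simp only [reflWeight, phase_eq hκ hab hσκ hy]
  rw [Finset.prod_mul_distrib, ← Complex.exp_sum, mul_left_comm, ← Complex.exp_add]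
  congr 2
  push_cast
  rw [mul_add, Finset.mul_sum, Finset.mul_sum]
  congr 1
  · ring
  · exact Finset.sum_congr rfl fun p _ => by ring

theorem ae_forall_apply_ne (n : ℕ) (c : ℝ) : ∀ᵐ y : Fin n → ℝ, ∀ p, y p ≠ c := by
  refine ae_all_iff.2 fun p => ?_
  exact (Measure.tendsto_eval_ae_ae (μ := fun _ : Fin n => (volume : Measure ℝ))
    (i := p)).eventually (Measure.ae_ne volume c)

theorem S_eq {σ κ ρ : ℝ → ℝ} (hκ : Continuous κ) (hρ : Continuous ρ)
    {a b : ℝ} (hab : a ≤ b) (hσκ : ∀ x ∈ Set.Icc a b, 1 / σ x = κ x)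
    (hσρ : ∀ x ∈ Set.Ioo a b, deriv σ x / σ x = 2 * ρ x) (k : ℂ) (n : ℕ) :
    S σ a b n k
      = (reflTerm κ ρ a (-k) n b - reflTerm κ ρ a k n b) * (Complex.I / 2) := by
  have hm := (isCompact_simplex a b n).measurableSet
  have hcont (k : ℂ) : IntegrableOn (fun y => (∏ p : Fin n, (ρ (y p) : ℂ)) *
      Complex.exp (Complex.I * k * phase σ a b n y)) (simplex a b n) := by
    have hτ := continuous_travelTime hκ a
    refine (ContinuousOn.integrableOn_compact (isCompact_simplex a b n)
      (f := fun y => (∏ p : Fin n, (ρ (y p) : ℂ)) * Complex.exp (Complex.I * k *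
        ((-1) ^ n * travelTime κ a b
          + 2 * ∑ p : Fin n, (-1 : ℝ) ^ (p : ℕ) * travelTime κ a (y p) : ℝ)))
      (Continuous.continuousOn (by fun_prop))).congr_fun (fun y hy => ?_) hm
    simp only [phase_eq hκ hab hσκ hy]
  rw [S, ← setIntegral_simplex_exp hκ hρ hab hσκ, ← setIntegral_simplex_exp hκ hρ hab hσκ,
    ← integral_sub (hcont _) (hcont _), ← integral_mul_const, ← integral_const_mul]
  refine setIntegral_congr_ae hm ?_
  filter_upwards [ae_forall_apply_ne n a, ae_forall_apply_ne n b] with y hya hyb hy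
  have hprod : (∏ p, deriv σ (y p) / σ (y p) : ℝ) = 2 ^ n * ∏ p, ρ (y p) := by
    rw [Finset.prod_congr rfl fun p _ => hσρ (y p)
      ⟨lt_of_le_of_ne (hy.2 p).1 (hya p).symm, lt_of_le_of_ne (hy.2 p).2 (hyb p)⟩,
      Finset.prod_mul_distrib]
    simp
  rw [Sintegrand, hprod, Complex.sin]
  have h2 : (2 : ℂ) ^ n ≠ 0 := pow_ne_zero _ two_ne_zero
  push_cast
  rw [mul_assoc, inv_mul_cancel_left₀ h2]
  rw [show -(k * (phase σ a b n y : ℂ)) * Complex.I = Complex.I * -k * phase σ a b n y by ring,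
    show k * (phase σ a b n y : ℂ) * Complex.I = Complex.I * k * phase σ a b n y by ring]
  ring

theorem tsum_S_eq {σ κ ρ : ℝ → ℝ} (hκ : Continuous κ) (hρ : Continuous ρ)
    {a b : ℝ} (hab : a ≤ b) (hσκ : ∀ x ∈ Set.Icc a b, 1 / σ x = κ x)
    (hσρ : ∀ x ∈ Set.Ioo a b, deriv σ x / σ x = 2 * ρ x) (k : ℂ) :
    ∑' n, S σ a b n k
      = (reflSeries κ ρ a (-k) 1 b - reflSeries κ ρ a k 1 b) * (Complex.I / 2) := by
  simp only [S_eq hκ hρ hab hσκ hσρ, reflSeries, one_pow, one_mul]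
  rw [tsum_mul_right, (summable_reflTerm hκ hρ a (-k) b).tsum_sub (summable_reflTerm hκ hρ a k b)]

/-! ### The discrete sums as a one-step recursion -/

/-- Weight `∏ (σ_{p+1} ± σ_p)/(σ_{p+1} + σ_p)` of the sign pattern `ℓ`. -/
def patternWeight (σ : ℝ → ℝ) (x : ℕ → ℝ) (m : ℕ) (ℓ : Fin m → Bool) : ℝ :=
  ∏ p ∈ Finset.Ico 1 m, (σ (x (p + 1)) +
    (if entry m ℓ p = entry m ℓ (p + 1) then σ (x p) else -σ (x p))) / (σ (x (p + 1)) + σ (x p))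

/-- Phase `∑ ± Δx_p/σ_p` of the sign pattern `ℓ`. -/
def patternPhase (σ : ℝ → ℝ) (x : ℕ → ℝ) (m : ℕ) (ℓ : Fin m → Bool) : ℝ :=
  ∑ p ∈ Finset.Icc 1 m,
    (if entry m ℓ p then (-1 : ℝ) else 1) * (x p - x (p - 1)) / σ (x p)

/-- Exponential sum over the sign patterns starting with `false` and ending with `s`. -/
def patternSum (σ : ℝ → ℝ) (k : ℂ) (x : ℕ → ℝ) (m : ℕ) (s : Bool) : ℂ :=
  ∑ ℓ : Fin m → Bool, if entry m ℓ 1 = false ∧ entry m ℓ m = s then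
    (patternWeight σ x m ℓ : ℂ) * Complex.exp (Complex.I * k * patternPhase σ x m ℓ) else 0

theorem Asum_eq_patternSum (σ : ℝ → ℝ) (k : ℂ) (x : ℕ → ℝ) (m : ℕ) :
    Asum σ k m x = ((patternSum σ (-k) x m false + patternSum σ (-k) x m true)
      - (patternSum σ k x m false + patternSum σ k x m true)) * (Complex.I / 2) := by
  simp only [Asum, patternSum]
  rw [← Finset.sum_add_distrib, ← Finset.sum_add_distrib, ← Finset.sum_sub_distrib, Finset.sum_mul]
  refine Finset.sum_congr rfl fun ℓ _ => ?_
  change (if entry m ℓ 1 = false then (patternWeight σ x m ℓ : ℂ) *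
    Complex.sin (k * (patternPhase σ x m ℓ : ℂ)) else 0) = _
  have e₁ : -(k * (patternPhase σ x m ℓ : ℂ)) * Complex.I
    = Complex.I * -k * patternPhase σ x m ℓ := by ring
  have e₂ : k * (patternPhase σ x m ℓ : ℂ) * Complex.I
    = Complex.I * k * patternPhase σ x m ℓ := by ring
  rw [Complex.sin, e₁, e₂]
  by_cases h : entry m ℓ 1 = false <;> cases hm : entry m ℓ m <;> simp [h] <;> ring

theorem entry_snoc_of_le {m p : ℕ} (ℓ : Fin m → Bool) (s : Bool) (hp : p ≤ m) :
    entry (m + 1) (Fin.snoc (α := fun _ => Bool) ℓ s) p = entry m ℓ p := by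
  unfold entry
  by_cases h : 1 ≤ p
  · rw [dif_pos ⟨h, by omega⟩, dif_pos ⟨h, hp⟩]
    exact Fin.snoc_castSucc (α := fun _ => Bool) s ℓ ⟨p - 1, by omega⟩
  · rw [dif_neg (fun h' => h h'.1), dif_neg (fun h' => h h'.1)]

theorem entry_snoc_last {m : ℕ} (ℓ : Fin m → Bool) (s : Bool) :
    entry (m + 1) (Fin.snoc (α := fun _ => Bool) ℓ s) (m + 1) = s := by
  unfold entry
  rw [dif_pos ⟨by omega, le_rfl⟩]
  exact Fin.snoc_last (α := fun _ => Bool) s ℓ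

theorem patternPhase_snoc (σ : ℝ → ℝ) (x : ℕ → ℝ) {m : ℕ} (ℓ : Fin m → Bool) (s : Bool) :
    patternPhase σ x (m + 1) (Fin.snoc (α := fun _ => Bool) ℓ s) = patternPhase σ x m ℓ
      + (if s then (-1 : ℝ) else 1) * (x (m + 1) - x m) / σ (x (m + 1)) := by
  rw [patternPhase, Finset.sum_Icc_succ_top (by omega), entry_snoc_last, Nat.add_sub_cancel,
    patternPhase]
  congr 1
  refine Finset.sum_congr rfl fun p hp => ?_
  rw [entry_snoc_of_le ℓ s (Finset.mem_Icc.1 hp).2]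

theorem patternWeight_snoc (σ : ℝ → ℝ) (x : ℕ → ℝ) {m : ℕ} (hm : 1 ≤ m) (ℓ : Fin m → Bool)
    (s : Bool) :
    patternWeight σ x (m + 1) (Fin.snoc (α := fun _ => Bool) ℓ s) = patternWeight σ x m ℓ
      * ((σ (x (m + 1)) + (if entry m ℓ m = s then σ (x m) else -σ (x m)))
        / (σ (x (m + 1)) + σ (x m))) := by
  rw [patternWeight, Finset.prod_Ico_succ_top hm, entry_snoc_last, entry_snoc_of_le ℓ s le_rfl,
    patternWeight]
  congr 1
  refine Finset.prod_congr rfl fun p hp => ?_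
  have := (Finset.mem_Ico.1 hp).2
  rw [entry_snoc_of_le ℓ s (by omega), entry_snoc_of_le ℓ s (by omega)]

theorem patternSum_one (σ : ℝ → ℝ) (k : ℂ) (x : ℕ → ℝ) (s : Bool) :
    patternSum σ k x 1 s = if s = false then
      Complex.exp (Complex.I * k * ((x 1 - x 0) / σ (x 1) : ℝ)) else 0 := by
  rw [patternSum, ← (Equiv.funUnique (Fin 1) Bool).symm.sum_comp, Fintype.sum_bool]
  cases s <;> simp [entry, patternWeight, patternPhase]

theorem patternSum_succ (σ : ℝ → ℝ) (k : ℂ) (x : ℕ → ℝ) {m : ℕ} (hm : 1 ≤ m) (s : Bool) :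
    patternSum σ k x (m + 1) s =
      Complex.exp (Complex.I * k *
        ((if s then (-1 : ℝ) else 1) * (x (m + 1) - x m) / σ (x (m + 1)) : ℝ)) *
      ∑ t : Bool, patternSum σ k x m t * ((σ (x (m + 1)) + (if t = s then σ (x m) else -σ (x m)))
        / (σ (x (m + 1)) + σ (x m)) : ℝ) := by
  have h₁ : patternSum σ k x (m + 1) s = ∑ ℓ : Fin m → Bool, if entry m ℓ 1 = false then
      (patternWeight σ x (m + 1) (Fin.snoc (α := fun _ => Bool) ℓ s) : ℂ) * Complex.exp
        (Complex.I * k * patternPhase σ x (m + 1) (Fin.snoc (α := fun _ => Bool) ℓ s)) else 0 := by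
    rw [patternSum, ← (Fin.snocEquiv fun _ => Bool).sum_comp, Fintype.sum_prod_type,
      Finset.sum_eq_single s]
    · refine Finset.sum_congr rfl fun ℓ _ => ?_
      change (if entry (m + 1) (Fin.snoc (α := fun _ => Bool) ℓ s) 1 = false ∧
        entry (m + 1) (Fin.snoc (α := fun _ => Bool) ℓ s) (m + 1) = s then
        (patternWeight σ x (m + 1) (Fin.snoc (α := fun _ => Bool) ℓ s) : ℂ) * Complex.exp
          (Complex.I * k * patternPhase σ x (m + 1) (Fin.snoc (α := fun _ => Bool) ℓ s))
          else 0) = _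
      simp [entry_snoc_of_le ℓ s hm, entry_snoc_last]
    · intro t _ hts
      refine Finset.sum_eq_zero fun ℓ _ => ?_
      change (if entry (m + 1) (Fin.snoc (α := fun _ => Bool) ℓ t) 1 = false ∧
        entry (m + 1) (Fin.snoc (α := fun _ => Bool) ℓ t) (m + 1) = s then
        (patternWeight σ x (m + 1) (Fin.snoc (α := fun _ => Bool) ℓ t) : ℂ) * Complex.exp
          (Complex.I * k * patternPhase σ x (m + 1) (Fin.snoc (α := fun _ => Bool) ℓ t))
          else 0) = 0
      simp [entry_snoc_last, hts]
    · simp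
  rw [h₁]
  simp only [patternSum, Finset.sum_mul]
  rw [Finset.sum_comm, Finset.mul_sum]
  refine Finset.sum_congr rfl fun ℓ _ => ?_
  rw [Finset.sum_eq_single (entry m ℓ m)]
  · rw [patternWeight_snoc σ x hm, patternPhase_snoc, Complex.ofReal_add, mul_add, Complex.exp_add,
      Complex.ofReal_mul]
    by_cases h : entry m ℓ 1 = false
    · simp only [h, and_self, if_true]
      ring
    · simp [h]
  · intro t _ ht
    rw [if_neg (fun h => ht h.2.symm), zero_mul]
  · simp

theorem patternSum_add_succ {σ : ℝ → ℝ} (k : ℂ) {x : ℕ → ℝ} {m : ℕ} (hm : 1 ≤ m)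
    (hσ : σ (x (m + 1)) + σ (x m) ≠ 0) :
    patternSum σ k x (m + 1) false + patternSum σ k x (m + 1) true =
      Complex.cos (k * ((x (m + 1) - x m) / σ (x (m + 1)) : ℝ)) *
        (1 + ((σ (x (m + 1)) - σ (x m)) / (σ (x (m + 1)) + σ (x m)) : ℝ)) *
        (patternSum σ k x m false + patternSum σ k x m true) +
      Complex.I * Complex.sin (k * ((x (m + 1) - x m) / σ (x (m + 1)) : ℝ)) *
        (1 - ((σ (x (m + 1)) - σ (x m)) / (σ (x (m + 1)) + σ (x m)) : ℝ)) *
        (patternSum σ k x m false - patternSum σ k x m true) := by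
  rw [patternSum_succ σ k x hm, patternSum_succ σ k x hm]
  simp only [Fintype.sum_bool, if_true, Bool.false_eq_true, Bool.true_eq_false, if_false,
    div_self hσ, ← sub_eq_add_neg]
  set r : ℝ := (σ (x (m + 1)) - σ (x m)) / (σ (x (m + 1)) + σ (x m))
  set d : ℝ := (x (m + 1) - x m) / σ (x (m + 1)) with hd
  rw [one_mul, neg_one_mul, neg_div, ← hd, Complex.cos, Complex.sin]
  rw [show k * (d : ℂ) * Complex.I = Complex.I * k * d by ring,
    show -(k * (d : ℂ)) * Complex.I = Complex.I * k * ((-d : ℝ) : ℂ) by push_cast; ring]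
  push_cast
  linear_combination (1 - (r : ℂ)) * (patternSum σ k x m false - patternSum σ k x m true) *
    (Complex.exp (Complex.I * k * d) - Complex.exp (Complex.I * k * -d)) / 2 * Complex.I_mul_I

theorem patternSum_sub_succ {σ : ℝ → ℝ} (k : ℂ) {x : ℕ → ℝ} {m : ℕ} (hm : 1 ≤ m)
    (hσ : σ (x (m + 1)) + σ (x m) ≠ 0) :
    patternSum σ k x (m + 1) false - patternSum σ k x (m + 1) true =
      Complex.cos (k * ((x (m + 1) - x m) / σ (x (m + 1)) : ℝ)) *
        (1 - ((σ (x (m + 1)) - σ (x m)) / (σ (x (m + 1)) + σ (x m)) : ℝ)) *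
        (patternSum σ k x m false - patternSum σ k x m true) +
      Complex.I * Complex.sin (k * ((x (m + 1) - x m) / σ (x (m + 1)) : ℝ)) *
        (1 + ((σ (x (m + 1)) - σ (x m)) / (σ (x (m + 1)) + σ (x m)) : ℝ)) *
        (patternSum σ k x m false + patternSum σ k x m true) := by
  rw [patternSum_succ σ k x hm, patternSum_succ σ k x hm]
  simp only [Fintype.sum_bool, if_true, Bool.false_eq_true, Bool.true_eq_false, if_false,
    div_self hσ, ← sub_eq_add_neg]
  set r : ℝ := (σ (x (m + 1)) - σ (x m)) / (σ (x (m + 1)) + σ (x m))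
  set d : ℝ := (x (m + 1) - x m) / σ (x (m + 1)) with hd
  rw [one_mul, neg_one_mul, neg_div, ← hd, Complex.cos, Complex.sin]
  rw [show k * (d : ℂ) * Complex.I = Complex.I * k * d by ring,
    show -(k * (d : ℂ)) * Complex.I = Complex.I * k * ((-d : ℝ) : ℂ) by push_cast; ring]
  push_cast
  linear_combination (1 + (r : ℂ)) * (patternSum σ k x m false + patternSum σ k x m true) *
    (Complex.exp (Complex.I * k * d) - Complex.exp (Complex.I * k * -d)) / 2 * Complex.I_mul_I

theorem Bsum_eq_Asum (σ : ℝ → ℝ) (k : ℂ) {j N : ℕ} (hj : j < N) (x : ℕ → ℝ) :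
    Bsum σ k j N x = Asum σ k (N - j) fun p => x (p + j) := by
  have he (ℓ : Fin (N - j) → Bool) (p : ℕ) : entryB j N ℓ (p + j) = entry (N - j) ℓ p := by
    unfold entryB entry
    by_cases h : 1 ≤ p ∧ p ≤ N - j
    · rw [dif_pos h, dif_pos (by omega)]
      congr 2
      omega
    · rw [dif_neg h, dif_neg (by omega)]
  have hs (p : ℕ) : p + j + 1 = p + 1 + j := by omega
  have hN : N = N - j + j := by omega
  simp only [Bsum, Asum]
  refine Finset.sum_congr rfl fun ℓ _ => ?_
  rw [add_comm j 1, he]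
  have h₁ (f : ℕ → ℝ) : ∏ p ∈ Finset.Ico (1 + j) N, f p = ∏ p ∈ Finset.Ico 1 (N - j), f (p + j) := by
    rw [Finset.prod_Ico_add' f 1 (N - j) j, ← hN]
  have h₂ (f : ℕ → ℝ) : ∑ p ∈ Finset.Icc (1 + j) N, f p = ∑ p ∈ Finset.Icc 1 (N - j), f (p + j) := by
    have := Finset.sum_map (Finset.Icc 1 (N - j)) (addRightEmbedding j) f
    rwa [Finset.map_add_right_Icc, ← hN] at this
  rw [h₁, h₂]
  simp only [hs, he]
  have h₃ : ∑ p ∈ Finset.Icc 1 (N - j), (if entry (N - j) ℓ p then (-1 : ℝ) else 1) *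
      (x (p + j) - x (p + j - 1)) / σ (x (p + j)) = ∑ p ∈ Finset.Icc 1 (N - j),
      (if entry (N - j) ℓ p then (-1 : ℝ) else 1) *
      (x (p + j) - x (p - 1 + j)) / σ (x (p + j)) := by
    refine Finset.sum_congr rfl fun p hp => ?_
    rw [Nat.sub_add_comm (Finset.mem_Icc.1 hp).1]
  rw [h₃]

/-! ### Consistency and stability of the recursion -/

open scoped Uniformity Asymptotics

/-- Pairs of points of `[a, b]` close to each other. -/
abbrev nearDiag (a b : ℝ) : Filter (ℝ × ℝ) := 𝓤 ℝ ⊓ 𝓟 (Set.Icc a b ×ˢ Set.Icc a b)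

/-- A `C¹` function on a compact interval is uniformly differentiable there. -/
theorem isLittleO_sub_sub_smul_of_hasDerivWithinAt {E : Type*} [NormedAddCommGroup E]
    [NormedSpace ℝ E] {f f' : ℝ → E} {a b : ℝ}
    (hf : ∀ t ∈ Set.Icc a b, HasDerivWithinAt f (f' t) (Set.Icc a b) t)
    (hf' : ContinuousOn f' (Set.Icc a b)) :
    (fun p : ℝ × ℝ => f p.2 - f p.1 - (p.2 - p.1) • f' p.1)
      =o[nearDiag a b] fun p => p.2 - p.1 := by
  refine Asymptotics.isLittleO_iff.2 fun ε hε => ?_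
  obtain ⟨δ, hδ, h⟩ := Metric.uniformContinuousOn_iff_le.1
    (isCompact_Icc.uniformContinuousOn_of_continuous hf') ε hε
  refine eventually_inf_principal.2 ?_
  filter_upwards [Metric.dist_mem_uniformity hδ] with p hp hps
  have hsub : Set.uIcc p.1 p.2 ⊆ Set.Icc a b := Set.ordConnected_Icc.uIcc_subset hps.1 hps.2
  have hd : ∀ t ∈ Set.uIcc p.1 p.2, HasDerivWithinAt (fun t => f t - (t - p.1) • f' p.1)
      (f' t - f' p.1) (Set.uIcc p.1 p.2) t := fun t ht => by
    have h₂ := ((hasDerivWithinAt_id t (Set.uIcc p.1 p.2)).sub_const p.1).smul_const (f' p.1)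
    rw [one_smul] at h₂
    exact ((hf t (hsub ht)).mono hsub).sub h₂
  have := (convex_uIcc p.1 p.2).norm_image_sub_le_of_norm_hasDerivWithin_le (C := ε) hd
    (fun t ht => ?_) Set.left_mem_uIcc Set.right_mem_uIcc
  · simpa [sub_right_comm] using this
  · rw [← dist_eq_norm]
    refine h t (hsub ht) p.1 hps.1 ?_
    have h₁ : |t - p.1| ≤ |p.2 - p.1| := Set.abs_sub_left_of_mem_uIcc ht
    rw [Real.dist_eq]
    refine h₁.trans ?_
    rw [← Real.dist_eq, dist_comm]
    exact le_of_lt hp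

theorem tendsto_comp_snd_sub_comp_fst {E : Type*} [NormedAddCommGroup E] {f : ℝ → E} {a b : ℝ}
    (hf : ContinuousOn f (Set.Icc a b)) :
    Tendsto (fun p : ℝ × ℝ => f p.2 - f p.1) (nearDiag a b) (nhds 0) := by
  refine Metric.tendsto_nhds.2 fun ε hε => ?_
  obtain ⟨δ, hδ, h⟩ := Metric.uniformContinuousOn_iff.1
    (isCompact_Icc.uniformContinuousOn_of_continuous hf) ε hε
  refine eventually_inf_principal.2 ?_
  filter_upwards [Metric.dist_mem_uniformity hδ] with p hp hps
  rw [dist_zero_right, ← dist_eq_norm, dist_comm]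
  exact h _ hps.1 _ hps.2 hp

theorem isBigO_one_comp_of_continuousOn {E X : Type*} [NormedAddCommGroup E] [TopologicalSpace X]
    {f : X → E} {s : Set X} {l : Filter X} (hs : IsCompact s) (hf : ContinuousOn f s) :
    f =O[l ⊓ 𝓟 s] fun _ => (1 : ℝ) := by
  obtain ⟨C, hC⟩ := hs.exists_bound_of_continuousOn hf
  refine Asymptotics.IsBigO.of_bound C (eventually_inf_principal.2 (Eventually.of_forall ?_))
  intro x hx
  simpa using hC x hx

/-- Reflection coefficient between neighbouring nodes. -/
def reflCoeff (σ : ℝ → ℝ) (p : ℝ × ℝ) : ℝ := (σ p.2 - σ p.1) / (σ p.2 + σ p.1)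

/-- Phase increment between neighbouring nodes. -/
def phaseStep (σ : ℝ → ℝ) (k : ℂ) (p : ℝ × ℝ) : ℂ := k * ((p.2 - p.1) / σ p.2 : ℝ)

theorem isBigO_ofReal_sub (l : Filter (ℝ × ℝ)) :
    (fun p : ℝ × ℝ => ((p.2 - p.1 : ℝ) : ℂ)) =O[l] fun p => p.2 - p.1 :=
  Asymptotics.isBigO_of_le _ fun _ => (Complex.norm_real _).le

section Consistency

variable {σ κ ρ : ℝ → ℝ} {a b : ℝ}

theorem tendsto_reflCoeff (hσc : ContinuousOn σ (Set.Icc a b))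
    (hσpos : ∀ x ∈ Set.Icc a b, 0 < σ x) :
    Tendsto (reflCoeff σ) (nearDiag a b) (nhds 0) := by
  have hO : (fun p : ℝ × ℝ => (σ p.2 + σ p.1)⁻¹)
      =O[nearDiag a b] fun _ => (1 : ℝ) := by
    refine isBigO_one_comp_of_continuousOn (isCompact_Icc.prod isCompact_Icc)
      (((hσc.comp continuousOn_snd fun p hp => hp.2).add
        (hσc.comp continuousOn_fst fun p hp => hp.1)).inv₀ fun p hp => ?_)
    exact (add_pos (hσpos _ hp.2) (hσpos _ hp.1)).ne'
  have h := ((Asymptotics.isLittleO_one_iff ℝ).2 (tendsto_comp_snd_sub_comp_fst hσc)).mul_isBigO hO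
  exact (Asymptotics.isLittleO_one_iff ℝ).1 (h.congr (fun _ => rfl) fun _ => one_mul _)

theorem isLittleO_reflCoeff_sub (hσpos : ∀ x ∈ Set.Icc a b, 0 < σ x) (hρ : Continuous ρ)
    (hσd : ∀ t ∈ Set.Icc a b, HasDerivWithinAt σ (2 * ρ t * σ t) (Set.Icc a b) t) :
    (fun p => reflCoeff σ p - ρ p.1 * (p.2 - p.1))
      =o[nearDiag a b] fun p => p.2 - p.1 := by
  have hσc : ContinuousOn σ (Set.Icc a b) := fun t ht => (hσd t ht).continuousWithinAt
  have hO : (fun p : ℝ × ℝ => (σ p.2 + σ p.1)⁻¹)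
      =O[nearDiag a b] fun _ => (1 : ℝ) := by
    refine isBigO_one_comp_of_continuousOn (isCompact_Icc.prod isCompact_Icc)
      (((hσc.comp continuousOn_snd fun p hp => hp.2).add
        (hσc.comp continuousOn_fst fun p hp => hp.1)).inv₀ fun p hp => ?_)
    exact (add_pos (hσpos _ hp.2) (hσpos _ hp.1)).ne'
  have hρO : (fun p : ℝ × ℝ => ρ p.1)
      =O[nearDiag a b] fun _ => (1 : ℝ) :=
    isBigO_one_comp_of_continuousOn (isCompact_Icc.prod isCompact_Icc) (by fun_prop)
  have h₁ := (isLittleO_sub_sub_smul_of_hasDerivWithinAt hσd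
    (by fun_prop)).mul_isBigO hO
  have h₂ := ((hρO.mul (Asymptotics.isBigO_refl (fun p : ℝ × ℝ => p.2 - p.1) _))).mul_isLittleO
    ((Asymptotics.isLittleO_one_iff ℝ).2 (tendsto_reflCoeff hσc hσpos))
  refine (((h₁.congr_right fun _ => mul_one _).sub
    (h₂.congr_right fun p => by ring)).congr' ?_ EventuallyEq.rfl)
  refine eventually_inf_principal.2 (Eventually.of_forall fun p hp => ?_)
  have : σ p.2 + σ p.1 ≠ 0 := (add_pos (hσpos _ hp.2) (hσpos _ hp.1)).ne'
  simp only [reflCoeff, smul_eq_mul]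
  field_simp
  ring

theorem isLittleO_phaseStep_sub (hκ : Continuous κ) (hσκ : ∀ x ∈ Set.Icc a b, 1 / σ x = κ x)
    (k : ℂ) :
    (fun p => phaseStep σ k p - k * κ p.1 * ((p.2 - p.1 : ℝ) : ℂ))
      =o[nearDiag a b] fun p => p.2 - p.1 := by
  have h₁ : Tendsto (fun p : ℝ × ℝ => k * (κ p.2 - κ p.1 : ℝ))
      (nearDiag a b) (nhds 0) := by
    simpa using ((Complex.continuous_ofReal.tendsto 0).comp
      (tendsto_comp_snd_sub_comp_fst (a := a) (b := b) hκ.continuousOn)).const_mul k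
  have h₂ := ((Asymptotics.isLittleO_one_iff ℝ).2 h₁).mul_isBigO (isBigO_ofReal_sub (nearDiag a b))
  refine (h₂.congr_right fun _ => one_mul _).congr' ?_ EventuallyEq.rfl
  refine eventually_inf_principal.2 (Eventually.of_forall fun p hp => ?_)
  simp only [phaseStep, ← hσκ _ hp.2]
  push_cast
  ring

theorem isBigO_phaseStep (hκ : Continuous κ) (hσκ : ∀ x ∈ Set.Icc a b, 1 / σ x = κ x) (k : ℂ) :
    phaseStep σ k =O[nearDiag a b] fun p => p.2 - p.1 := by
  have hO : (fun p : ℝ × ℝ => k * (κ p.1 : ℂ)) =O[nearDiag a b] fun _ => (1 : ℝ) :=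
    isBigO_one_comp_of_continuousOn (isCompact_Icc.prod isCompact_Icc) (by fun_prop)
  have h := (isLittleO_phaseStep_sub hκ hσκ k).isBigO.add
    ((hO.mul (isBigO_ofReal_sub (nearDiag a b))).congr_right fun _ => one_mul _)
  exact h.congr_left fun p => by ring

theorem isLittleO_cos_phaseStep (hκ : Continuous κ) (hρ : Continuous ρ)
    (hσpos : ∀ x ∈ Set.Icc a b, 0 < σ x) (hσκ : ∀ x ∈ Set.Icc a b, 1 / σ x = κ x)
    (hσd : ∀ t ∈ Set.Icc a b, HasDerivWithinAt σ (2 * ρ t * σ t) (Set.Icc a b) t) (k s : ℂ) :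
    (fun p => Complex.cos (phaseStep σ k p) * (1 + s * reflCoeff σ p) - 1
        - s * ρ p.1 * ((p.2 - p.1 : ℝ) : ℂ)) =o[nearDiag a b] fun p => p.2 - p.1 := by
  have hσc : ContinuousOn σ (Set.Icc a b) := fun t ht => (hσd t ht).continuousWithinAt
  have hθ := isBigO_phaseStep hκ hσκ k
  have hθ0 := hθ.trans_tendsto (tendsto_comp_snd_sub_comp_fst (a := a) (b := b) continuousOn_id)
  have hr := (Complex.continuous_ofReal.tendsto 0).comp (tendsto_reflCoeff hσc hσpos)
  have hr1 : (fun p => 1 + s * (reflCoeff σ p : ℂ)) =O[nearDiag a b] fun _ => (1 : ℝ) :=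
    (tendsto_const_nhds.add (hr.const_mul s)).isBigO_one ℝ
  have hcos : (fun p => Complex.cos (phaseStep σ k p) - 1) =o[nearDiag a b] fun p => p.2 - p.1 := by
    have h := (hasDerivAt_iff_isLittleO.1 (Complex.hasDerivAt_cos 0)).comp_tendsto hθ0
    refine (h.congr_left fun p => ?_).trans_isBigO (hθ.congr_left fun p => ?_)
    · simp
    · simp
  have hrl : (fun p => ((reflCoeff σ p - ρ p.1 * (p.2 - p.1) : ℝ) : ℂ)) =o[nearDiag a b]
      fun p => p.2 - p.1 :=
    (Asymptotics.isBigO_of_le _ fun _ => (Complex.norm_real _).le).trans_isLittleO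
      (isLittleO_reflCoeff_sub hσpos hρ hσd)
  have h := ((hcos.mul_isBigO hr1).congr_right fun _ => mul_one _).add (hrl.const_mul_left s)
  refine h.congr_left fun p => ?_
  push_cast
  ring

theorem isLittleO_sin_phaseStep (hκ : Continuous κ)
    (hσc : ContinuousOn σ (Set.Icc a b))
    (hσpos : ∀ x ∈ Set.Icc a b, 0 < σ x) (hσκ : ∀ x ∈ Set.Icc a b, 1 / σ x = κ x)
    (k s : ℂ) :
    (fun p => Complex.sin (phaseStep σ k p) * (1 - s * reflCoeff σ p)
        - k * κ p.1 * ((p.2 - p.1 : ℝ) : ℂ)) =o[nearDiag a b] fun p => p.2 - p.1 := by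
  have hθ := isBigO_phaseStep hκ hσκ k
  have hθ0 := hθ.trans_tendsto (tendsto_comp_snd_sub_comp_fst (a := a) (b := b) continuousOn_id)
  have hr : Tendsto (fun p => s * (reflCoeff σ p : ℂ)) (nearDiag a b) (nhds 0) := by
    simpa using ((Complex.continuous_ofReal.tendsto 0).comp
      (tendsto_reflCoeff hσc hσpos)).const_mul s
  have hr1 : (fun p => 1 - s * (reflCoeff σ p : ℂ)) =O[nearDiag a b] fun _ => (1 : ℝ) :=
    (tendsto_const_nhds.sub hr).isBigO_one ℝ
  have hsin : (fun p => Complex.sin (phaseStep σ k p) - phaseStep σ k p)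
      =o[nearDiag a b] fun p => p.2 - p.1 := by
    have h := (hasDerivAt_iff_isLittleO.1 (Complex.hasDerivAt_sin 0)).comp_tendsto hθ0
    refine (h.congr_left fun p => ?_).trans_isBigO (hθ.congr_left fun p => ?_)
    · simp
    · simp
  have h₁ := (((hsin.add (isLittleO_phaseStep_sub hκ hσκ k)).mul_isBigO hr1).congr_right
    fun _ => mul_one _)
  have hO : (fun p : ℝ × ℝ => k * (κ p.1 : ℂ)) =O[nearDiag a b] fun _ => (1 : ℝ) :=
    isBigO_one_comp_of_continuousOn (isCompact_Icc.prod isCompact_Icc) (by fun_prop)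
  have h₂ := ((hO.mul (isBigO_ofReal_sub (nearDiag a b))).mul_isLittleO
    ((Asymptotics.isLittleO_one_iff ℝ).2 hr)).congr_right (g₂ := fun p => p.2 - p.1)
    fun p => by ring
  exact (h₁.sub h₂).congr_left fun p => by ring

theorem isLittleO_reflSeries_step (hκ : Continuous κ) (hρ : Continuous ρ)
    (hσpos : ∀ x ∈ Set.Icc a b, 0 < σ x) (hσκ : ∀ x ∈ Set.Icc a b, 1 / σ x = κ x)
    (hσd : ∀ t ∈ Set.Icc a b, HasDerivWithinAt σ (2 * ρ t * σ t) (Set.Icc a b) t)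
    (c : ℝ) (k : ℂ) {s : ℂ} (hs : ‖s‖ ≤ 1) :
    (fun p => reflSeries κ ρ c k s p.2 -
      (Complex.cos (phaseStep σ k p) * (1 + s * reflCoeff σ p) * reflSeries κ ρ c k s p.1 +
        Complex.I * Complex.sin (phaseStep σ k p) * (1 - s * reflCoeff σ p) *
          reflSeries κ ρ c k (-s) p.1))
      =o[nearDiag a b] fun p => p.2 - p.1 := by
  have hσc : ContinuousOn σ (Set.Icc a b) := fun t ht => (hσd t ht).continuousWithinAt
  have hd {s : ℂ} (hs : ‖s‖ ≤ 1) := hasDerivAt_reflSeries hκ hρ c k hs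
  have hs' : ‖-s‖ ≤ 1 := by rwa [norm_neg]
  have hc {s : ℂ} (hs : ‖s‖ ≤ 1) : Continuous (reflSeries κ ρ c k s) :=
    continuous_iff_continuousAt.2 fun x => (hd hs x).continuousAt
  have hc₁ := hc hs
  have hc₂ := hc hs'
  have hO {s : ℂ} (hs : ‖s‖ ≤ 1) :
      (fun p : ℝ × ℝ => reflSeries κ ρ c k s p.1) =O[nearDiag a b] fun _ => (1 : ℝ) :=
    isBigO_one_comp_of_continuousOn (isCompact_Icc.prod isCompact_Icc)
      ((hc hs).comp continuous_fst).continuousOn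
  have h₁ := isLittleO_sub_sub_smul_of_hasDerivWithinAt (a := a) (b := b)
    (fun t _ => (hd hs t).hasDerivWithinAt) (by fun_prop)
  have h₂ := ((isLittleO_cos_phaseStep hκ hρ hσpos hσκ hσd k s).mul_isBigO (hO hs)).congr_right
    fun _ => mul_one _
  have h₃ := (((isLittleO_sin_phaseStep hκ hσc hσpos hσκ k s).const_mul_left Complex.I).mul_isBigO
    (hO hs')).congr_right fun _ => mul_one _
  refine ((h₁.sub h₂).sub h₃).congr_left fun p => ?_
  rw [Complex.real_smul]
  ring

theorem isBigO_cos_phaseStep (hκ : Continuous κ) (hρ : Continuous ρ)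
    (hσpos : ∀ x ∈ Set.Icc a b, 0 < σ x) (hσκ : ∀ x ∈ Set.Icc a b, 1 / σ x = κ x)
    (hσd : ∀ t ∈ Set.Icc a b, HasDerivWithinAt σ (2 * ρ t * σ t) (Set.Icc a b) t) (k s : ℂ) :
    (fun p => Complex.cos (phaseStep σ k p) * (1 + s * reflCoeff σ p) - 1)
      =O[nearDiag a b] fun p => p.2 - p.1 := by
  have hO : (fun p : ℝ × ℝ => s * (ρ p.1 : ℂ)) =O[nearDiag a b] fun _ => (1 : ℝ) :=
    isBigO_one_comp_of_continuousOn (isCompact_Icc.prod isCompact_Icc) (by fun_prop)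
  have h := (isLittleO_cos_phaseStep hκ hρ hσpos hσκ hσd k s).isBigO.add
    ((hO.mul (isBigO_ofReal_sub (nearDiag a b))).congr_right fun _ => one_mul _)
  exact h.congr_left fun p => by ring

theorem isBigO_sin_phaseStep (hκ : Continuous κ)
    (hσc : ContinuousOn σ (Set.Icc a b))
    (hσpos : ∀ x ∈ Set.Icc a b, 0 < σ x) (hσκ : ∀ x ∈ Set.Icc a b, 1 / σ x = κ x)
    (k s : ℂ) :
    (fun p => Complex.I * Complex.sin (phaseStep σ k p) * (1 - s * reflCoeff σ p))
      =O[nearDiag a b] fun p => p.2 - p.1 := by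
  have hO : (fun p : ℝ × ℝ => k * (κ p.1 : ℂ)) =O[nearDiag a b] fun _ => (1 : ℝ) :=
    isBigO_one_comp_of_continuousOn (isCompact_Icc.prod isCompact_Icc) (by fun_prop)
  have h := ((isLittleO_sin_phaseStep hκ hσc hσpos hσκ k s).isBigO.add
    ((hO.mul (isBigO_ofReal_sub (nearDiag a b))).congr_right fun _ => one_mul _)).const_mul_left
    Complex.I
  exact h.congr_left fun p => by ring

end Consistency

/-- Discrete Gronwall inequality along a partition. -/
theorem le_exp_mul_of_step_le {e x : ℕ → ℝ} {C ε : ℝ} (hC : 0 ≤ C) (hε : 0 ≤ ε)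
    (he : ∀ p, 0 ≤ e p) {m n : ℕ} (hmn : m ≤ n) (hx : ∀ p, m ≤ p → p < n → x p ≤ x (p + 1))
    (hstep : ∀ p, m ≤ p → p < n →
      e (p + 1) ≤ (1 + C * (x (p + 1) - x p)) * e p + ε * (x (p + 1) - x p)) :
    e n ≤ Real.exp (C * (x n - x m)) * (e m + ε * (x n - x m)) := by
  induction n, hmn using Nat.le_induction with
  | base => simp
  | succ n hmn ih =>
    have hn := ih (fun p h₁ h₂ => hx p h₁ (h₂.trans n.lt_succ_self))
      fun p h₁ h₂ => hstep p h₁ (h₂.trans n.lt_succ_self)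
    have hd : 0 ≤ x (n + 1) - x n := sub_nonneg.2 (hx n hmn n.lt_succ_self)
    have hm : x m ≤ x (n + 1) := by
      have h := monotoneOn_of_le_add_one (Set.ordConnected_Icc (a := m) (b := n + 1))
        (f := x) fun p _ h₁ h₂ => hx p h₁.1 h₂.2
      exact h ⟨le_rfl, by omega⟩ ⟨by omega, le_rfl⟩ (by omega)
    have h₁ : 1 + C * (x (n + 1) - x n) ≤ Real.exp (C * (x (n + 1) - x n)) := by
      rw [add_comm]; exact Real.add_one_le_exp _
    have h₂ : 1 ≤ Real.exp (C * (x (n + 1) - x m)) :=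
      Real.one_le_exp (mul_nonneg hC (sub_nonneg.2 hm))
    calc e (n + 1) ≤ Real.exp (C * (x (n + 1) - x n)) *
          (Real.exp (C * (x n - x m)) * (e m + ε * (x n - x m))) +
            1 * (ε * (x (n + 1) - x n)) := by
          rw [one_mul]
          exact (hstep n hmn n.lt_succ_self).trans (add_le_add_left
            (mul_le_mul h₁ hn (he n) (Real.exp_pos _).le) _)
      _ ≤ Real.exp (C * (x (n + 1) - x n)) *
          (Real.exp (C * (x n - x m)) * (e m + ε * (x n - x m))) +
            Real.exp (C * (x (n + 1) - x m)) * (ε * (x (n + 1) - x n)) := by gcongr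
      _ = Real.exp (C * (x (n + 1) - x m)) * (e m + ε * (x (n + 1) - x m)) := by
          rw [← mul_assoc, ← Real.exp_add]
          ring_nf

section Convergence

variable {σ κ ρ : ℝ → ℝ} {a b : ℝ}

/-- One step of the discrete recursion amplifies the distance to the reflection series by at most
`1 + O(h)`, up to `o(h)`. -/
theorem exists_step_bound (hκ : Continuous κ) (hρ : Continuous ρ)
    (hσpos : ∀ x ∈ Set.Icc a b, 0 < σ x) (hσκ : ∀ x ∈ Set.Icc a b, 1 / σ x = κ x)
    (hσd : ∀ t ∈ Set.Icc a b, HasDerivWithinAt σ (2 * ρ t * σ t) (Set.Icc a b) t)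
    (c : ℝ) (k : ℂ) :
    ∃ C, 0 ≤ C ∧ ∀ ε > 0, ∀ᶠ p in nearDiag a b, ∀ t q : ℂ,
      ‖Complex.cos (phaseStep σ k p) * (1 + reflCoeff σ p) * t +
          Complex.I * Complex.sin (phaseStep σ k p) * (1 - reflCoeff σ p) * q -
          reflSeries κ ρ c k 1 p.2‖ +
        ‖Complex.cos (phaseStep σ k p) * (1 - reflCoeff σ p) * q +
          Complex.I * Complex.sin (phaseStep σ k p) * (1 + reflCoeff σ p) * t -
          reflSeries κ ρ c k (-1) p.2‖ ≤
      (1 + C * |p.2 - p.1|) *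
          (‖t - reflSeries κ ρ c k 1 p.1‖ + ‖q - reflSeries κ ρ c k (-1) p.1‖) +
        ε * |p.2 - p.1| := by
  have hσc : ContinuousOn σ (Set.Icc a b) := fun t ht => (hσd t ht).continuousWithinAt
  obtain ⟨C₁, h₁, H₁⟩ := (isBigO_cos_phaseStep hκ hρ hσpos hσκ hσd k 1).exists_pos
  obtain ⟨C₂, h₂, H₂⟩ := (isBigO_cos_phaseStep hκ hρ hσpos hσκ hσd k (-1)).exists_pos
  obtain ⟨C₃, h₃, H₃⟩ := (isBigO_sin_phaseStep hκ hσc hσpos hσκ k 1).exists_pos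
  obtain ⟨C₄, h₄, H₄⟩ := (isBigO_sin_phaseStep hκ hσc hσpos hσκ k (-1)).exists_pos
  refine ⟨C₁ + C₂ + C₃ + C₄, by positivity, fun ε hε => ?_⟩
  filter_upwards [H₁.bound, H₂.bound, H₃.bound, H₄.bound,
    (isLittleO_reflSeries_step hκ hρ hσpos hσκ hσd c k (s := 1) (by simp)).bound (half_pos hε),
    (isLittleO_reflSeries_step hκ hρ hσpos hσκ hσd c k (s := -1) (by simp)).bound (half_pos hε)]
    with p g₁ g₂ g₃ g₄ g₅ g₆ t q
  simp only [one_mul, neg_one_mul, neg_neg, Real.norm_eq_abs, sub_neg_eq_add,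
    ← sub_eq_add_neg] at g₁ g₂ g₃ g₄ g₅ g₆
  set u := Complex.cos (phaseStep σ k p) * (1 + reflCoeff σ p)
  set v := Complex.cos (phaseStep σ k p) * (1 - reflCoeff σ p)
  set w := Complex.I * Complex.sin (phaseStep σ k p) * (1 - reflCoeff σ p)
  set z := Complex.I * Complex.sin (phaseStep σ k p) * (1 + reflCoeff σ p)
  set T := reflSeries κ ρ c k 1
  set Q := reflSeries κ ρ c k (-1)
  set h := |p.2 - p.1|
  have key {u w t q T Q T' : ℂ} {C C' δ : ℝ} (hu : ‖u - 1‖ ≤ C) (hw : ‖w‖ ≤ C')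
      (hT : ‖T' - (u * T + w * Q)‖ ≤ δ) :
      ‖u * t + w * q - T'‖ ≤ ‖t - T‖ + C * ‖t - T‖ + C' * ‖q - Q‖ + δ := by
    have : u * t + w * q - T' = (t - T) + (u - 1) * (t - T) + w * (q - Q)
        - (T' - (u * T + w * Q)) := by ring
    rw [this]
    refine (norm_sub_le _ _).trans (add_le_add ((norm_add₃_le).trans ?_) hT)
    rw [norm_mul, norm_mul]
    gcongr
  have k₁ := key (t := t) (q := q) g₁ g₃ g₅
  have k₂ := key (t := q) (q := t) g₂ g₄ g₆
  have e₁ := mul_nonneg (abs_nonneg (p.2 - p.1)) (norm_nonneg (t - T p.1))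
  have e₂ := mul_nonneg (abs_nonneg (p.2 - p.1)) (norm_nonneg (q - Q p.1))
  nlinarith [mul_nonneg h₁.le e₁, mul_nonneg h₂.le e₁, mul_nonneg h₃.le e₁, mul_nonneg h₄.le e₁,
    mul_nonneg h₁.le e₂, mul_nonneg h₂.le e₂, mul_nonneg h₃.le e₂, mul_nonneg h₄.le e₂]

/-- Convergence of the sums over sign patterns to the reflection series. -/
theorem tendsto_patternSum (hκ : Continuous κ) (hρ : Continuous ρ)
    (hσpos : ∀ x ∈ Set.Icc a b, 0 < σ x) (hσκ : ∀ x ∈ Set.Icc a b, 1 / σ x = κ x)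
    (hσd : ∀ t ∈ Set.Icc a b, HasDerivWithinAt σ (2 * ρ t * σ t) (Set.Icc a b) t)
    {ι : Type*} {l : Filter ι} {n : ι → ℕ} {X : ι → ℕ → ℝ} {c d : ℝ} (hn : ∀ i, 1 ≤ n i)
    (hX : ∀ i, ∀ p ≤ n i, X i p ∈ Set.Icc a b) (hXm : ∀ i, ∀ p < n i, X i p ≤ X i (p + 1))
    (hmesh : ∀ δ > 0, ∀ᶠ i in l, ∀ p < n i, X i (p + 1) - X i p < δ)
    (hc : Tendsto (fun i => X i 0) l (nhds c)) (hd : Tendsto (fun i => X i (n i)) l (nhds d))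
    (k : ℂ) :
    Tendsto (fun i => patternSum σ k (X i) (n i) false + patternSum σ k (X i) (n i) true) l
      (nhds (reflSeries κ ρ c k 1 d)) := by
  obtain ⟨C, hC, hstep⟩ := exists_step_bound hκ hρ hσpos hσκ hσd c k
  have hcont {s : ℂ} (hs : ‖s‖ ≤ 1) : Continuous (reflSeries κ ρ c k s) :=
    continuous_iff_continuousAt.2 fun x => (hasDerivAt_reflSeries hκ hρ c k hs x).continuousAt
  have hc₁ : Continuous (reflSeries κ ρ c k 1) := hcont (by simp)
  have hc₂ : Continuous (reflSeries κ ρ c k (-1)) := hcont (by simp)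
  set e : ι → ℕ → ℝ := fun i p =>
    ‖patternSum σ k (X i) p false + patternSum σ k (X i) p true - reflSeries κ ρ c k 1 (X i p)‖ +
    ‖patternSum σ k (X i) p false - patternSum σ k (X i) p true - reflSeries κ ρ c k (-1) (X i p)‖
    with he
  have hstep0 : Tendsto (fun i => X i 1 - X i 0) l (nhds 0) := by
    refine Metric.tendsto_nhds.2 fun δ hδ => ?_
    filter_upwards [hmesh δ hδ] with i hi
    rw [Real.dist_0_eq_abs, abs_of_nonneg (sub_nonneg.2 (hXm i 0 (hn i)))]
    exact hi 0 (hn i)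
  have hX1 : Tendsto (fun i => X i 1) l (nhds c) := by
    simpa using hstep0.add hc
  have hθ : Tendsto (fun i => Complex.exp (Complex.I * k * ((X i 1 - X i 0) / σ (X i 1) : ℝ))) l
      (nhds 1) := by
    have h : Tendsto (fun i => (X i 1 - X i 0) * κ (X i 1)) l (nhds 0) := by
      simpa using hstep0.mul ((hκ.tendsto c).comp hX1)
    have h' := (Complex.continuous_exp.tendsto _).comp
      (((Complex.continuous_ofReal.tendsto 0).comp h).const_mul (Complex.I * k))
    simp only [Complex.ofReal_zero, mul_zero, Complex.exp_zero] at h'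
    refine h'.congr fun i => ?_
    simp only [Function.comp_apply, ← hσκ _ (hX i 1 (hn i)), div_eq_mul_one_div (X i 1 - X i 0)]
  have he1 : Tendsto (fun i => e i 1) l (nhds 0) := by
    have h := (hθ.sub ((hc₁.tendsto c).comp hX1)).norm.add
      (hθ.sub ((hc₂.tendsto c).comp hX1)).norm
    simpa [he, patternSum_one, reflSeries_self] using h
  have hen : Tendsto (fun i => e i (n i)) l (nhds 0) := by
    refine Metric.tendsto_nhds.2 fun η hη => ?_
    have hM : 0 < 1 + |b - a| := by positivity
    set ε := η / (Real.exp (C * |b - a|) * (1 + |b - a|)) with hε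
    have hε0 : 0 < ε := by positivity
    obtain ⟨δ, hδ, hδs⟩ := Metric.mem_uniformity_dist.1 (mem_inf_principal.1 (hstep ε hε0))
    filter_upwards [hmesh δ hδ, he1.eventually_lt_const hε0] with i hi hi1
    have hb : X i (n i) - X i 1 ≤ |b - a| :=
      (sub_le_sub (hX i _ le_rfl).2 (hX i 1 (hn i)).1).trans (le_abs_self _)
    have hG := le_exp_mul_of_step_le (e := e i) (x := X i) hC hε0.le
      (fun p => by positivity) (hn i) (fun p _ hp => hXm i p hp) fun p hp hpn => ?_
    · rw [Real.dist_0_eq_abs, abs_of_nonneg (by positivity)]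
      calc e i (n i) ≤ Real.exp (C * (X i (n i) - X i 1)) *
            (e i 1 + ε * (X i (n i) - X i 1)) := hG
        _ ≤ Real.exp (C * (X i (n i) - X i 1)) * (e i 1 + ε * |b - a|) := by gcongr
        _ ≤ Real.exp (C * |b - a|) * (e i 1 + ε * |b - a|) := by gcongr
        _ < Real.exp (C * |b - a|) * (ε + ε * |b - a|) := by gcongr
        _ = η := by rw [hε]; field_simp
    · have hh : 0 ≤ X i (p + 1) - X i p := sub_nonneg.2 (hXm i p hpn)
      have hmem := hX i p hpn.le
      have hmem' := hX i (p + 1) hpn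
      have := hδs (a := X i p) (b := X i (p + 1)) (by
        rw [dist_comm, Real.dist_eq, abs_of_nonneg hh]; exact hi p hpn) ⟨hmem, hmem'⟩
        (patternSum σ k (X i) p false + patternSum σ k (X i) p true)
        (patternSum σ k (X i) p false - patternSum σ k (X i) p true)
      have hne : σ (X i (p + 1)) + σ (X i p) ≠ 0 := (add_pos (hσpos _ hmem') (hσpos _ hmem)).ne'
      rw [abs_of_nonneg hh] at this
      simp only [he, patternSum_add_succ k hp hne, patternSum_sub_succ k hp hne]
      exact this
  have h := (squeeze_zero_norm (fun i => le_add_of_nonneg_right (norm_nonneg _)) hen).add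
    ((hc₁.tendsto d).comp hd)
  simpa using h

/-- Convergence of the discrete sine sums to the series of iterated sine integrals. -/
theorem tendsto_Asum (hκ : Continuous κ) (hρ : Continuous ρ)
    (hσpos : ∀ x ∈ Set.Icc a b, 0 < σ x) (hσκ : ∀ x ∈ Set.Icc a b, 1 / σ x = κ x)
    (hσd : ∀ t ∈ Set.Icc a b, HasDerivWithinAt σ (2 * ρ t * σ t) (Set.Icc a b) t)
    {ι : Type*} {l : Filter ι} {n : ι → ℕ} {X : ι → ℕ → ℝ} {c d : ℝ} (hn : ∀ i, 1 ≤ n i)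
    (hX : ∀ i, ∀ p ≤ n i, X i p ∈ Set.Icc a b) (hXm : ∀ i, ∀ p < n i, X i p ≤ X i (p + 1))
    (hmesh : ∀ δ > 0, ∀ᶠ i in l, ∀ p < n i, X i (p + 1) - X i p < δ)
    (hc : Tendsto (fun i => X i 0) l (nhds c)) (hd : Tendsto (fun i => X i (n i)) l (nhds d))
    (hac : a ≤ c) (hcd : c ≤ d) (hdb : d ≤ b) (k : ℂ) :
    Tendsto (fun i => Asum σ k (n i) (X i)) l (nhds (∑' n, S σ c d n k)) := by
  have hsub : Set.Icc c d ⊆ Set.Icc a b := Set.Icc_subset_Icc hac hdb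
  rw [tsum_S_eq hκ hρ hcd (fun t ht => hσκ t (hsub ht)) (fun t ht => ?_) k]
  · simp only [Asum_eq_patternSum]
    exact ((tendsto_patternSum hκ hρ hσpos hσκ hσd hn hX hXm hmesh hc hd (-k)).sub
      (tendsto_patternSum hκ hρ hσpos hσκ hσd hn hX hXm hmesh hc hd k)).mul_const _
  · have htm := hsub (Set.Ioo_subset_Icc_self ht)
    rw [((hσd t htm).hasDerivAt (Icc_mem_nhds (hac.trans_lt ht.1) (ht.2.trans_le hdb))).deriv]
    exact mul_div_cancel_right₀ _ (hσpos t htm).ne'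

end Convergence

section Prefactor

theorem one_sub_sum_le_prod_one_sub {ι : Type*} {s : Finset ι} {f : ι → ℝ}
    (h₀ : ∀ i ∈ s, 0 ≤ f i) (h₁ : ∀ i ∈ s, f i ≤ 1) :
    1 - ∑ i ∈ s, f i ≤ ∏ i ∈ s, (1 - f i) := by
  induction s using Finset.cons_induction with
  | empty => simp
  | cons i s hi ih =>
    simp only [Finset.mem_cons, forall_eq_or_imp] at h₀ h₁
    have ih := ih h₀.2 h₁.2
    have hle : ∏ i ∈ s, (1 - f i) ≤ 1 :=
      Finset.prod_le_one (fun i hi => sub_nonneg.2 (h₁.2 i hi))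
        fun i hi => sub_le_self _ (h₀.2 i hi)
    rw [Finset.sum_cons, Finset.prod_cons]
    nlinarith [mul_le_mul_of_nonneg_left hle h₀.1]

theorem mul_prod_sq_eq_mul_prod_one_sub_sq {s : ℕ → ℝ} {m n : ℕ} (hmn : m ≤ n)
    (hs : ∀ p, m ≤ p → p ≤ n → 0 < s p) :
    s n * ∏ p ∈ Finset.Ico m n, (2 * s p / (s (p + 1) + s p)) ^ 2 =
      s m * ∏ p ∈ Finset.Ico m n, (1 - ((s (p + 1) - s p) / (s (p + 1) + s p)) ^ 2) := by
  induction n, hmn using Nat.le_induction with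
  | base => simp
  | succ n hmn ih =>
    have ih := ih fun p h₁ h₂ => hs p h₁ (h₂.trans n.le_succ)
    have hn := hs n hmn n.le_succ
    have hn' := hs (n + 1) (hmn.trans n.le_succ) le_rfl
    rw [Finset.prod_Ico_succ_top hmn, Finset.prod_Ico_succ_top hmn, ← mul_assoc (s m), ← ih]
    field_simp
    ring

variable {σ ρ : ℝ → ℝ} {a b : ℝ}

theorem isLittleO_reflCoeff_sq (hσpos : ∀ x ∈ Set.Icc a b, 0 < σ x) (hρ : Continuous ρ)
    (hσd : ∀ t ∈ Set.Icc a b, HasDerivWithinAt σ (2 * ρ t * σ t) (Set.Icc a b) t) :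
    (fun p => reflCoeff σ p ^ 2) =o[nearDiag a b] fun p => p.2 - p.1 := by
  have hσc : ContinuousOn σ (Set.Icc a b) := fun t ht => (hσd t ht).continuousWithinAt
  have hρO : (fun p : ℝ × ℝ => ρ p.1) =O[nearDiag a b] fun _ => (1 : ℝ) :=
    isBigO_one_comp_of_continuousOn (isCompact_Icc.prod isCompact_Icc) (by fun_prop)
  have hO : reflCoeff σ =O[nearDiag a b] fun p => p.2 - p.1 :=
    ((isLittleO_reflCoeff_sub hσpos hρ hσd).isBigO.add
      ((hρO.mul (Asymptotics.isBigO_refl (fun p : ℝ × ℝ => p.2 - p.1) _)).congr_right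
        fun _ => one_mul _)).congr_left fun p => by ring
  exact (((Asymptotics.isLittleO_one_iff ℝ).2 (tendsto_reflCoeff hσc hσpos)).mul_isBigO
    hO).congr (fun p => (sq _).symm) fun _ => one_mul _

/-- The transmission prefactor tends to `1`. -/
theorem tendsto_sqrt_mul_prod (hρ : Continuous ρ) (hσpos : ∀ x ∈ Set.Icc a b, 0 < σ x)
    (hσd : ∀ t ∈ Set.Icc a b, HasDerivWithinAt σ (2 * ρ t * σ t) (Set.Icc a b) t)
    {ι : Type*} {l : Filter ι} {m j : ι → ℕ} {X : ι → ℕ → ℝ} {c : ℝ} (hmj : ∀ i, m i ≤ j i)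
    (hX : ∀ i, ∀ p ≤ j i + 1, X i p ∈ Set.Icc a b)
    (hXm : ∀ i, ∀ p < j i + 1, X i p ≤ X i (p + 1))
    (hmesh : ∀ δ > 0, ∀ᶠ i in l, ∀ p < j i + 1, X i (p + 1) - X i p < δ)
    (hcm : c ∈ Set.Icc a b) (hc : Tendsto (fun i => X i (j i)) l (nhds c)) :
    Tendsto (fun i => Real.sqrt (σ (X i (j i)) / σ (X i (m i))) *
      ∏ p ∈ Finset.Icc (m i) (j i), 2 * σ (X i p) / (σ (X i (p + 1)) + σ (X i p))) l (nhds 1) := by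
  have hσc : ContinuousOn σ (Set.Icc a b) := fun t ht => (hσd t ht).continuousWithinAt
  have hpos (i p) (hp : p ≤ j i + 1) : 0 < σ (X i p) := hσpos _ (hX i p hp)
  set r : ι → ℕ → ℝ := fun i p => reflCoeff σ (X i p, X i (p + 1)) with hr
  have hrdef (i p) : r i p = (σ (X i (p + 1)) - σ (X i p)) / (σ (X i (p + 1)) + σ (X i p)) := rfl
  have hr1 (i p) (hp : p < j i + 1) : r i p ^ 2 ≤ 1 := by
    have h₁ := hpos i p hp.le
    have h₂ := hpos i (p + 1) hp
    rw [hrdef, div_pow, div_le_one (by positivity)]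
    nlinarith [mul_pos h₁ h₂]
  have heq (i) : Real.sqrt (σ (X i (j i)) / σ (X i (m i))) *
      ∏ p ∈ Finset.Icc (m i) (j i), 2 * σ (X i p) / (σ (X i (p + 1)) + σ (X i p)) =
      Real.sqrt (σ (X i (j i)) / σ (X i (j i + 1)) *
        ∏ p ∈ Finset.Ico (m i) (j i + 1), (1 - r i p ^ 2)) := by
    have h := mul_prod_sq_eq_mul_prod_one_sub_sq (s := fun p => σ (X i p))
      ((hmj i).trans (j i).le_succ) fun p _ hp => hpos i p hp
    have hP : 0 ≤ ∏ p ∈ Finset.Ico (m i) (j i + 1),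
        2 * σ (X i p) / (σ (X i (p + 1)) + σ (X i p)) :=
      Finset.prod_nonneg fun p hp => by
        have h₁ := hpos i p (Finset.mem_Ico.1 hp).2.le
        have h₂ := hpos i (p + 1) (Finset.mem_Ico.1 hp).2
        positivity
    rw [← Finset.Ico_add_one_right_eq_Icc, ← Real.sqrt_sq hP, ← Real.sqrt_mul
      (div_pos (hpos i _ (j i).le_succ) (hpos i _ ((hmj i).trans (j i).le_succ))).le,
      ← Finset.prod_pow]
    congr 1
    have h₁ := hpos i (m i) ((hmj i).trans (j i).le_succ)
    have h₂ := hpos i (j i + 1) le_rfl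
    simp only [hrdef]
    rw [div_mul_eq_mul_div, div_mul_eq_mul_div, div_eq_div_iff h₁.ne' h₂.ne']
    linear_combination σ (X i (j i)) * h
  simp only [heq]
  have hprod : Tendsto (fun i => ∏ p ∈ Finset.Ico (m i) (j i + 1), (1 - r i p ^ 2)) l
      (nhds 1) := by
    refine Metric.tendsto_nhds.2 fun η hη => ?_
    have hM : 0 < 1 + |b - a| := by positivity
    obtain ⟨δ, hδ, hδs⟩ := Metric.mem_uniformity_dist.1 (mem_inf_principal.1
      ((isLittleO_reflCoeff_sq hσpos hρ hσd).bound (div_pos hη hM)))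
    filter_upwards [hmesh δ hδ] with i hi
    have hsum : ∑ p ∈ Finset.Ico (m i) (j i + 1), r i p ^ 2 < η := by
      calc ∑ p ∈ Finset.Ico (m i) (j i + 1), r i p ^ 2
          ≤ ∑ p ∈ Finset.Ico (m i) (j i + 1), η / (1 + |b - a|) * (X i (p + 1) - X i p) := by
            refine Finset.sum_le_sum fun p hp => ?_
            have hp := (Finset.mem_Ico.1 hp).2
            have hh : 0 ≤ X i (p + 1) - X i p := sub_nonneg.2 (hXm i p hp)
            have := hδs (a := X i p) (b := X i (p + 1)) (by
              rw [dist_comm, Real.dist_eq, abs_of_nonneg hh]; exact hi p hp)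
              ⟨hX i p hp.le, hX i (p + 1) hp⟩
            simp only [Set.mem_ofPred_eq, Real.norm_eq_abs, abs_of_nonneg hh, abs_sq] at this
            exact this
        _ = η / (1 + |b - a|) * (X i (j i + 1) - X i (m i)) := by
            rw [← Finset.mul_sum, Finset.sum_Ico_sub (X i) ((hmj i).trans (j i).le_succ)]
        _ ≤ η / (1 + |b - a|) * |b - a| := by
            gcongr
            exact (sub_le_sub (hX i _ le_rfl).2
              (hX i _ ((hmj i).trans (j i).le_succ)).1).trans (le_abs_self _)
        _ < η := by
            rw [div_mul_eq_mul_div, div_lt_iff₀ hM]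
            nlinarith
    have hle : ∏ p ∈ Finset.Ico (m i) (j i + 1), (1 - r i p ^ 2) ≤ 1 :=
      Finset.prod_le_one (fun p hp => sub_nonneg.2 (hr1 i p (Finset.mem_Ico.1 hp).2))
        fun p _ => sub_le_self _ (sq_nonneg _)
    have hge : 1 - ∑ p ∈ Finset.Ico (m i) (j i + 1), r i p ^ 2 ≤
        ∏ p ∈ Finset.Ico (m i) (j i + 1), (1 - r i p ^ 2) :=
      one_sub_sum_le_prod_one_sub (fun _ _ => sq_nonneg _)
        fun p hp => hr1 i p (Finset.mem_Ico.1 hp).2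
    rw [Real.dist_eq, abs_sub_lt_iff]
    constructor <;> linarith
  have hX' : Tendsto (fun i => X i (j i + 1)) l (nhds c) := by
    have h : Tendsto (fun i => X i (j i + 1) - X i (j i)) l (nhds 0) := by
      refine Metric.tendsto_nhds.2 fun δ hδ => ?_
      filter_upwards [hmesh δ hδ] with i hi
      rw [Real.dist_0_eq_abs, abs_of_nonneg (sub_nonneg.2 (hXm i _ (j i).lt_succ_self))]
      exact hi _ (j i).lt_succ_self
    simpa using h.add hc
  have hσX {f : ι → ℕ} (hf : ∀ i, f i ≤ j i + 1) (h : Tendsto (fun i => X i (f i)) l (nhds c)) :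
      Tendsto (fun i => σ (X i (f i))) l (nhds (σ c)) :=
    (hσc c hcm).tendsto.comp
      (tendsto_nhdsWithin_iff.2 ⟨h, Eventually.of_forall fun i => hX i _ (hf i)⟩)
  have h := (((hσX (fun i => (j i).le_succ) hc).div (hσX (fun _ => le_rfl) hX')
    (hσpos c hcm).ne').mul hprod).sqrt
  simpa [div_self (hσpos c hcm).ne'] using h

end Prefactor

/-- convergence of the discrete kernel `Ψ_{j,m}` to `Ψ(k,x,y)` along any
sequence of partitions with mesh tending to `0` and `x_{m_N} → y`, `x_{j_N} → x`. -/
theorem stmt_12 (σ : ℝ → ℝ)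
    (hσ : ContDiffOn ℝ 2 σ (Set.Icc 0 1))
    (hσpos : ∀ x ∈ Set.Icc (0 : ℝ) 1, 0 < σ x)
    (k : ℂ) (xpt ypt : ℝ) (hy : 0 < ypt) (hyx : ypt < xpt) (hx : xpt < 1)
    (N : ℕ → ℕ) (xs : ℕ → ℕ → ℝ)
    (hN : ∀ i, 1 ≤ N i)
    (hx0 : ∀ i, xs i 0 = 0) (hxN : ∀ i, xs i (N i) = 1)
    (hmono : ∀ i, ∀ p < N i, xs i p < xs i (p + 1))
    (hmesh : Tendsto (fun i => (Finset.range (N i)).sup'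
        (Finset.nonempty_range_iff.mpr (Nat.one_le_iff_ne_zero.mp (hN i)))
        (fun p => xs i (p + 1) - xs i p)) atTop (nhds 0))
    (m j : ℕ → ℕ)
    (hm : ∀ i, 1 ≤ m i) (hmj : ∀ i, m i < j i) (hj : ∀ i, j i ≤ N i - 1)
    (hmy : Tendsto (fun i => xs i (m i)) atTop (nhds ypt))
    (hjx : Tendsto (fun i => xs i (j i)) atTop (nhds xpt)) :
    Tendsto (fun i => PsiDisc σ k (N i) (xs i) (j i) (m i)) atTop
      (nhds (Psi σ k xpt ypt)) := by
  have hjN (i) : j i < N i := by have := hj i; have := hN i; omega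
  have hσ1 : ContDiffOn ℝ 1 σ (Set.Icc 0 1) := hσ.of_le (by norm_num)
  have hD := hσ1.continuousOn_derivWithin (uniqueDiffOn_Icc zero_lt_one) le_rfl
  set κ : ℝ → ℝ := Set.IccExtend zero_le_one fun t : Set.Icc (0 : ℝ) 1 => 1 / σ t
  set ρ : ℝ → ℝ := Set.IccExtend zero_le_one fun t : Set.Icc (0 : ℝ) 1 =>
    derivWithin σ (Set.Icc 0 1) t / (2 * σ t)
  have hκ : Continuous κ := by
    refine Continuous.Icc_extend' (ContinuousOn.domRestrict
      (f := fun t => 1 / σ t) (continuousOn_const.div hσ.continuousOn fun t ht => (hσpos t ht).ne'))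
  have hρ : Continuous ρ := by
    refine Continuous.Icc_extend' (ContinuousOn.domRestrict
      (f := fun t => derivWithin σ (Set.Icc 0 1) t / (2 * σ t))
      (hD.div (continuousOn_const.mul hσ.continuousOn) fun t ht =>
        (mul_pos two_pos (hσpos t ht)).ne'))
  have hσκ : ∀ t ∈ Set.Icc (0 : ℝ) 1, 1 / σ t = κ t := fun t ht =>
    (Set.IccExtend_of_mem zero_le_one (fun t : Set.Icc (0 : ℝ) 1 => 1 / σ t) ht).symm
  have hσd : ∀ t ∈ Set.Icc (0 : ℝ) 1,
      HasDerivWithinAt σ (2 * ρ t * σ t) (Set.Icc 0 1) t := fun t ht => by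
    have h := (hσ1.differentiableOn one_ne_zero t ht).hasDerivWithinAt
    have hρt : ρ t = derivWithin σ (Set.Icc 0 1) t / (2 * σ t) :=
      Set.IccExtend_of_mem zero_le_one _ ht
    rwa [show derivWithin σ (Set.Icc 0 1) t = 2 * ρ t * σ t by
      rw [hρt]; have := (hσpos t ht).ne'; field_simp] at h
  have hX (i) : ∀ p ≤ N i, xs i p ∈ Set.Icc (0 : ℝ) 1 := by
    have h := monotoneOn_of_le_add_one (Set.ordConnected_Icc (a := 0) (b := N i))
      (f := xs i) fun p _ _ h₂ => (hmono i p h₂.2).le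
    intro p hp
    rw [← hx0 i, ← hxN i]
    exact ⟨h ⟨le_rfl, by omega⟩ ⟨by omega, hp⟩ (by omega),
      h ⟨by omega, hp⟩ ⟨by omega, le_rfl⟩ hp⟩
  have hmesh' : ∀ δ > 0, ∀ᶠ i in atTop, ∀ p < N i, xs i (p + 1) - xs i p < δ := fun δ hδ => by
    filter_upwards [hmesh.eventually_lt_const hδ] with i hi p hp
    exact (Finset.le_sup' (fun p => xs i (p + 1) - xs i p) (Finset.mem_range.2 hp)).trans_lt hi
  have hA := tendsto_Asum hκ hρ hσpos hσκ hσd (n := m) (X := xs) (c := 0) hm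
    (fun i p hp => hX i p (by have := hmj i; have := hjN i; omega))
    (fun i p hp => (hmono i p (by have := hmj i; have := hjN i; omega)).le)
    (fun δ hδ => (hmesh' δ hδ).mono fun i hi p hp =>
      hi p (by have := hmj i; have := hjN i; omega))
    (by simp only [hx0]; exact tendsto_const_nhds) hmy le_rfl hy.le (hyx.trans hx).le k
  have hB := tendsto_Asum hκ hρ hσpos hσκ hσd (n := fun i => N i - j i)
    (X := fun i p => xs i (p + j i)) (c := xpt) (d := 1)
    (fun i => by have := hjN i; omega)
    (fun i p hp => hX i _ (by have := hjN i; omega))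
    (fun i p hp => by rw [add_right_comm]; exact (hmono i _ (by omega)).le)
    (fun δ hδ => (hmesh' δ hδ).mono fun i hi p hp => by
      rw [add_right_comm]; exact hi _ (by omega))
    (by simpa using hjx)
    (by
      refine tendsto_const_nhds.congr fun i => ?_
      rw [Nat.sub_add_cancel (hjN i).le, hxN i])
    (hy.trans hyx).le hx.le le_rfl k
  have hP := tendsto_sqrt_mul_prod hρ hσpos hσd (m := m) (j := j) (X := xs) (l := atTop)
    (fun i => (hmj i).le) (fun i p hp => hX i p (by have := hjN i; omega))
    (fun i p hp => (hmono i p (by have := hjN i; omega)).le)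
    (fun δ hδ => (hmesh' δ hδ).mono fun i hi p hp => hi p (by have := hjN i; omega))
    ⟨(hy.trans hyx).le, hx.le⟩ hjx
  have h := ((((Complex.continuous_ofReal.tendsto 1).comp hP).mul hA).mul hB)
  rw [Psi, if_pos hyx.le]
  simp only [Complex.ofReal_one, one_mul] at h
  refine h.congr fun i => ?_
  rw [PsiDisc, Bsum_eq_Asum σ k (hjN i)]
  rfl
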